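/- arXiv:1701.01330 — 18 statements merged into one kernel-verified Lean document; each statement's English description precedes it below -/
import Mathlib

section
/- Let G be a finite group, N a normal subgroup of G, A a G-module, and s : G/N → G a section of the quotient map with s(1)=1. Then for every 2-cocycle α ∈ Z²(G,A), all σ, τ ∈ G/N, and every lift σ̃ ∈ G of σ, the Akizuki–Witt cocycle satisfies the identity AW~(α)(σ,τ) = ∏_{n∈N} ( α(n, s(σ)) · σ̃(α(n, s(τ))) / α(n, s(στ)) ) · ( α(σ̃, n·s(τ)) / α(σ̃, n) ). -/
/-- A product over the right coset `Ng` equals the product over the left coset `hN` when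
`g` and `h` have the same image in `G ⧸ N`. -/
theorem Subgroup.Normal.prod_mul_right_eq_prod_mul_left {G M : Type*} [Group G] [CommMonoid M]
    (N : Subgroup G) [N.Normal] [Fintype N] {g h : G} (hgh : (g : G ⧸ N) = h) (f : G → M) :
    ∏ n : N, f (n * g) = ∏ n : N, f (h * n) := by
  have hmem (n : N) : h⁻¹ * (n * g) ∈ N := by
    rw [← QuotientGroup.eq_one_iff]
    simp [(QuotientGroup.eq_one_iff (n : G)).2 n.2, hgh]
  have hinj : Function.Injective fun n : N ↦ (⟨h⁻¹ * (n * g), hmem n⟩ : N) := fun a b hab ↦ by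
    simpa using hab
  exact Fintype.prod_bijective _ (Finite.injective_iff_bijective.1 hinj) _ _ fun n ↦ by simp


/-- For a finite group `G`, a normal subgroup `N`, a `G`-module `A`,
a section `s : G/N → G` of the quotient map with `s 1 = 1`, any 2-cocycle `α`,
any `σ τ : G/N` and any lift `σ̃` of `σ`, the Akizuki–Witt cocycle
`AW~(α)(σ,τ) = ∏_{n∈N} n(α(s σ, s τ)) · α(n, s σ · s τ) / α(n, s (στ))` equals
`∏_{n∈N} (α(n, s σ) · σ̃(α(n, s τ)) / α(n, s (στ))) · (α(σ̃, n · s τ) / α(σ̃, n))`. -/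
theorem akizuki_witt_formula {G : Type*} [Group G] [Fintype G]
    (N : Subgroup G) [N.Normal] [Fintype N]
    {A : Type*} [CommGroup A] [MulDistribMulAction G A]
    (s : G ⧸ N → G) (hs : ∀ x : G ⧸ N, ((s x : G) : G ⧸ N) = x) (hs1 : s 1 = 1)
    (α : G → G → A)
    (hα : ∀ σ τ υ : G, σ • α τ υ * α σ (τ * υ) = α (σ * τ) υ * α σ τ)
    (σ τ : G ⧸ N) (σt : G) (hσt : ((σt : G ⧸ N)) = σ) :
    (∏ n : N, (n : G) • α (s σ) (s τ) * α (n : G) (s σ * s τ) / α (n : G) (s (σ * τ)))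
      = ∏ n : N,
          (α (n : G) (s σ) * σt • α (n : G) (s τ) / α (n : G) (s (σ * τ)))
            * (α σt ((n : G) * s τ) / α σt (n : G)) := by
  have hleft (n : N) :
      (n : G) • α (s σ) (s τ) * α (n : G) (s σ * s τ) / α (n : G) (s (σ * τ))
        = α (n * s σ) (s τ) * (α (n : G) (s σ) / α (n : G) (s (σ * τ))) := by
    rw [hα, mul_div_assoc]
  have hright (n : N) :
      (α (n : G) (s σ) * σt • α (n : G) (s τ) / α (n : G) (s (σ * τ)))
          * (α σt ((n : G) * s τ) / α σt (n : G))
        = α (σt * n) (s τ) * (α (n : G) (s σ) / α (n : G) (s (σ * τ))) := by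
    calc
      _ = (σt • α (n : G) (s τ) * α σt ((n : G) * s τ)) / α σt (n : G)
            * (α (n : G) (s σ) / α (n : G) (s (σ * τ))) := by
        simp only [div_eq_mul_inv]
        ac_rfl
      _ = _ := by rw [hα, mul_div_cancel_right]
  simp only [hleft, hright, Finset.prod_mul_distrib]
  rw [Subgroup.Normal.prod_mul_right_eq_prod_mul_left N ((hs σ).trans hσt.symm) (α · (s τ))]
end

section
/- Let G be a finite group, N a normal subgroup of G, A a G-module, and s : G/N → G a section of the quotient map with s(1)=1. Then for every 2-cocycle α₀ ∈ Z²(G,A) there exists a map β : G → A such that the cohomologous cocycle α := α₀ · dβ satisfies α(n, s(σ)) = 1 for all n ∈ N and all σ ∈ G/N. In other words, every cohomology class in H²(G,A) contains a 2-cocycle α with α(n, s(σ)) = 1 for all n ∈ N and σ ∈ G/N. -/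
/-- Every cohomology class in `H²(G,A)` contains a 2-cocycle `α`
with `α(n, s σ) = 1` for all `n ∈ N` and `σ ∈ G/N`: given a 2-cocycle `α₀`,
there is a 1-cochain `β : G → A` such that the cohomologous cocycle
`α = α₀ · dβ` satisfies `α(n, s σ) = 1` for all `n ∈ N`, `σ ∈ G/N`. -/
theorem good_cocycle_in_class {G : Type*} [Group G] [Fintype G]
    (N : Subgroup G) [N.Normal] [Fintype N]
    {A : Type*} [CommGroup A] [MulDistribMulAction G A]
    (s : G ⧸ N → G) (hs : ∀ x : G ⧸ N, ((s x : G) : G ⧸ N) = x) (hs1 : s 1 = 1)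
    (α₀ : G → G → A)
    (hα₀ : ∀ σ τ υ : G, σ • α₀ τ υ * α₀ σ (τ * υ) = α₀ (σ * τ) υ * α₀ σ τ) :
    ∃ β : G → A, ∀ (n : N) (σ : G ⧸ N),
      α₀ (n : G) (s σ) * (β (n : G) * (n : G) • β (s σ) * (β ((n : G) * s σ))⁻¹) = 1 := by
  have cocycle_one_right (g : G) : α₀ g 1 = g • α₀ 1 1 := by
    simpa using (hα₀ g 1 1).symm
  have cocycle_one_left (g : G) : α₀ 1 g = α₀ 1 1 := by
    simpa using hα₀ 1 1 g
  let c : A := (α₀ 1 1)⁻¹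
  let β : G → A := fun g ↦ α₀ (g * (s g)⁻¹) (s g) * (c * (g * (s g)⁻¹) • c)
  have mk_mul (n : N) (σ : G ⧸ N) : (((n : G) * s σ : G) : G ⧸ N) = σ := by
    rw [QuotientGroup.mk_mul, (QuotientGroup.eq_one_iff (n : G)).2 n.2, one_mul, hs]
  have β_mul (n : N) (σ : G ⧸ N) :
      β ((n : G) * s σ) = α₀ (n : G) (s σ) * (c * (n : G) • c) := by
    simp only [β, mk_mul, mul_inv_cancel_right]
  have β_coe (n : N) : β (n : G) = c := by
    have h := β_mul n 1
    rw [hs1, mul_one, cocycle_one_right] at h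
    simpa [c, mul_comm, mul_left_comm, mul_assoc] using h
  have β_section (σ : G ⧸ N) : β (s σ) = c := by
    have h := β_mul 1 σ
    rw [OneMemClass.coe_one, one_mul, one_smul, cocycle_one_left] at h
    simpa [c] using h
  refine ⟨β, fun n σ ↦ ?_⟩
  rw [β_mul, β_coe, β_section, ← mul_assoc, mul_inv_cancel]
end

section
/- Let G be a finite group, N a normal subgroup of G, and A a G-module. For every 2-cocycle α ∈ Z²(G,A), the map G → A/A^N sending σ to the class of ∏_{n∈N} α(n,σ) modulo A^N descends to a map G/N → A/A^N sending the identity coset to the identity. Precisely: (i) if σ, σ' ∈ G lie in the same coset of N then ∏_{n∈N} α(n,σ) and ∏_{n∈N} α(n,σ') differ by an element of A^N; (ii) if σ ∈ N then ∏_{n∈N} α(n,σ) ∈ A^N. -/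
/-- Reindexing a product over a normal subgroup along two elements of the same coset. -/
lemma prod_normal_mul_eq_of_coe_eq {G M : Type*} [Group G] (N : Subgroup G) [N.Normal]
    [Fintype N] [CommMonoid M] (f : G → M) {σ σ' : G} (h : (σ : G ⧸ N) = (σ' : G ⧸ N)) :
    ∏ n : N, f (n * σ') = ∏ n : N, f (n * σ) := by
  have hk : σ' * σ⁻¹ ∈ N :=
    (Subgroup.Normal.mem_comm_iff inferInstance).1 (QuotientGroup.eq.1 h)
  refine Fintype.prod_equiv (Equiv.mulRight (⟨σ' * σ⁻¹, hk⟩ : N)) _ _ fun n => ?_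
  simp [mul_assoc]

/-- The cocycle identity multiplied over a subgroup in the middle variable. -/
lemma smul_prod_cocycle_mul_prod {G : Type*} [Group G] (N : Subgroup G) [Fintype N]
    {A : Type*} [CommGroup A] [MulDistribMulAction G A] (α : G → G → A)
    (hα : ∀ σ τ υ : G, σ • α τ υ * α σ (τ * υ) = α (σ * τ) υ * α σ τ) (m : N) (σ : G) :
    (m : G) • (∏ n : N, α n σ) * ∏ n : N, α m (n * σ) =
      (∏ n : N, α n σ) * ∏ n : N, α m n := by
  have hm : ∏ n : N, α (m * n) σ = ∏ n : N, α n σ :=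
    Fintype.prod_equiv (Equiv.mulLeft m) _ _ fun n => by simp
  rw [Finset.smul_prod', ← Finset.prod_mul_distrib]
  simp only [hα]
  rw [Finset.prod_mul_distrib, hm]

/-- For a 2-cocycle `α ∈ Z²(G,A)`, the map `σ ↦ ∏_{n∈N} α(n,σ) mod A^N`
descends to a map `G/N → A/A^N` sending the identity coset to the identity:
(i) if `σ, σ'` lie in the same coset of `N`, the two products differ by an element
of `A^N`; (ii) if `σ ∈ N`, then `∏_{n∈N} α(n,σ) ∈ A^N`. -/
theorem prod_descends_mod_invariants {G : Type*} [Group G] [Fintype G]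
    (N : Subgroup G) [N.Normal] [Fintype N]
    {A : Type*} [CommGroup A] [MulDistribMulAction G A]
    (α : G → G → A)
    (hα : ∀ σ τ υ : G, σ • α τ υ * α σ (τ * υ) = α (σ * τ) υ * α σ τ) :
    (∀ σ σ' : G, ((σ : G ⧸ N)) = ((σ' : G ⧸ N)) →
       ∃ a : A, (∀ m : N, (m : G) • a = a) ∧
         (∏ n : N, α (n : G) σ') = (∏ n : N, α (n : G) σ) * a) ∧
    (∀ σ : G, σ ∈ N → ∀ m : N,
       (m : G) • (∏ n : N, α (n : G) σ) = ∏ n : N, α (n : G) σ) := by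
  refine ⟨fun σ σ' h => ⟨(∏ n : N, α n σ') / ∏ n : N, α n σ, fun m => ?_, by simp⟩,
    fun σ hσ m => ?_⟩
  · have h₁ := smul_prod_cocycle_mul_prod N α hα m σ
    have h₂ := smul_prod_cocycle_mul_prod N α hα m σ'
    rw [prod_normal_mul_eq_of_coe_eq N (α m) h] at h₂
    rw [smul_div', eq_mul_inv_of_mul_eq h₁, eq_mul_inv_of_mul_eq h₂, mul_div_mul_right_eq_div,
      mul_div_mul_right_eq_div]
  · have h₁ := smul_prod_cocycle_mul_prod N α hα m σ
    have h : ((1 : G) : G ⧸ N) = (σ : G ⧸ N) := QuotientGroup.eq.2 (by simpa using hσ)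
    rw [prod_normal_mul_eq_of_coe_eq N (α m) h] at h₁
    simpa using h₁
end

section
/- Let G be a finite group, N a normal subgroup of G, and A a G-module. For every 2-cocycle α ∈ Z²(G,A), the following conditions are equivalent: (1) the map AW²(α) : G × G/N → A factors through (G/N) × (G/N), i.e. AW²(α)(σ,τ) depends on σ only through its image in G/N; (2) AW²(α)(n, τ) = 1 for all n ∈ N and all τ ∈ G/N; (3) ∏_{n∈N} α(n, σ) ∈ A^N for all σ ∈ G. -/
section

variable {G A : Type*} [Group G] [CommGroup A]
  (N : Subgroup G) [Fintype N]

/-- The product of a function over the coset of `N` represented by `t` does not depend on `t`. -/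
theorem prod_mul_right_eq_of_coset_eq [N.Normal] (f : G → A) {s t : G}
    (h : (s : G ⧸ N) = (t : G ⧸ N)) : ∏ n : N, f (n * s) = ∏ n : N, f (n * t) := by
  have hm : t * s⁻¹ ∈ N := by
    have hst := QuotientGroup.eq.mp h
    exact Subgroup.Normal.mem_comm inferInstance hst
  rw [← Equiv.prod_comp (Equiv.mulRight (⟨t * s⁻¹, hm⟩ : N)) fun n : N => f (n * s)]
  simp [mul_assoc]

variable [MulDistribMulAction G A]

/-- The 2-cocycle identity at `(σ, n, t)`, multiplied over `n ∈ N`. -/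
theorem smul_prod_mul_prod_div_of_cocycle {α : G → G → A}
    (hα : ∀ σ τ υ : G, σ • α τ υ * α σ (τ * υ) = α (σ * τ) υ * α σ τ) (σ t : G) :
    σ • (∏ n : N, α n t) * (∏ n : N, α σ (n * t) / α σ n) = ∏ n : N, α (σ * n) t := by
  rw [Finset.smul_prod', ← Finset.prod_mul_distrib]
  refine Finset.prod_congr rfl fun n _ => ?_
  rw [← mul_div_assoc, hα, mul_div_cancel_right]

theorem cocycle_one_left_eq {α : G → G → A}
    (hα : ∀ σ τ υ : G, σ • α τ υ * α σ (τ * υ) = α (σ * τ) υ * α σ τ) (t : G) :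
    α 1 t = α 1 1 := by
  simpa using hα 1 1 t

/-- `AW²(α)(m, t)` is trivial iff `m` fixes `∏ n, α n t`. -/
theorem prod_div_eq_one_iff_of_cocycle {α : G → G → A}
    (hα : ∀ σ τ υ : G, σ • α τ υ * α σ (τ * υ) = α (σ * τ) υ * α σ τ) (m : N) (t : G) :
    (∏ n : N, α m (n * t) / α m n) = 1 ↔ (m : G) • (∏ n : N, α n t) = ∏ n : N, α n t := by
  have h := smul_prod_mul_prod_div_of_cocycle N hα m t
  have hshift : ∏ n : N, α ((m : G) * n) t = ∏ n : N, α n t := by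
    simpa using Equiv.prod_comp (Equiv.mulLeft m) fun n : N => α n t
  rw [hshift] at h
  exact ⟨fun h1 => by rwa [h1, mul_one] at h, fun h1 => by rwa [h1, mul_eq_left] at h⟩

end

/-- For a 2-cocycle `α ∈ Z²(G,A)` and
`AW²(α)(σ,τ) = ∏_{n∈N} α(σ, n·τ̃)/α(σ,n)` (with `τ̃ = L τ` a fixed choice of lifts),
the following are equivalent:
(1) `AW²(α)(σ,τ)` depends on `σ` only through its image in `G/N`;
(2) `AW²(α)(n,τ) = 1` for all `n ∈ N`, `τ ∈ G/N`;
(3) `∏_{n∈N} α(n,σ) ∈ A^N` for all `σ ∈ G`. -/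
theorem AW2_factors_tfae {G : Type*} [Group G] [Fintype G]
    (N : Subgroup G) [N.Normal] [Fintype N]
    {A : Type*} [CommGroup A] [MulDistribMulAction G A]
    (L : G ⧸ N → G) (hL : ∀ q : G ⧸ N, ((L q : G) : G ⧸ N) = q)
    (α : G → G → A)
    (hα : ∀ σ τ υ : G, σ • α τ υ * α σ (τ * υ) = α (σ * τ) υ * α σ τ) :
    ((∀ σ σ' : G, ((σ : G ⧸ N)) = ((σ' : G ⧸ N)) → ∀ τ : G ⧸ N,
        (∏ n : N, α σ ((n : G) * L τ) / α σ (n : G))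
          = ∏ n : N, α σ' ((n : G) * L τ) / α σ' (n : G))
      ↔ (∀ m : N, ∀ τ : G ⧸ N,
          (∏ n : N, α (m : G) ((n : G) * L τ) / α (m : G) (n : G)) = 1)) ∧
    ((∀ m : N, ∀ τ : G ⧸ N,
        (∏ n : N, α (m : G) ((n : G) * L τ) / α (m : G) (n : G)) = 1)
      ↔ (∀ σ : G, ∀ m : N,
          (m : G) • (∏ n : N, α (n : G) σ) = ∏ n : N, α (n : G) σ)) := by
  have inv_iff : (∀ m : N, ∀ τ : G ⧸ N,
      (∏ n : N, α (m : G) ((n : G) * L τ) / α (m : G) (n : G)) = 1)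
      ↔ (∀ σ : G, ∀ m : N,
        (m : G) • (∏ n : N, α (n : G) σ) = ∏ n : N, α (n : G) σ) := by
    refine ⟨fun h σ m => ?_, fun h m τ => (prod_div_eq_one_iff_of_cocycle N hα m _).2 (h _ m)⟩
    rw [← prod_div_eq_one_iff_of_cocycle N hα, ← h m σ, Finset.prod_div_distrib,
      Finset.prod_div_distrib, prod_mul_right_eq_of_coset_eq N (α m) (hL σ)]
  refine ⟨⟨fun h m τ => ?_, fun h σ σ' hσ τ => ?_⟩, inv_iff⟩
  · rw [h m 1 ((QuotientGroup.eq_one_iff _).2 m.2) τ]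
    refine Finset.prod_eq_one fun n _ => ?_
    rw [cocycle_one_left_eq hα, cocycle_one_left_eq hα n, div_self']
  · obtain ⟨m, rfl⟩ : ∃ m : N, σ' = σ * m := ⟨⟨_, QuotientGroup.eq.mp hσ⟩, by simp⟩
    have hm := smul_prod_mul_prod_div_of_cocycle N hα (σ * m) (L τ)
    have hshift : ∏ n : N, α (σ * m * n) (L τ) = ∏ n : N, α (σ * n) (L τ) := by
      simpa [mul_assoc] using Equiv.prod_comp (Equiv.mulLeft m) fun n : N => α (σ * n) (L τ)
    rw [hshift, ← smul_prod_mul_prod_div_of_cocycle N hα σ, mul_smul, inv_iff.1 h] at hm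
    exact (mul_left_cancel hm).symm
end

section
/- Let G be a finite group, N a normal subgroup of G, A a G-module, and s : G/N → G a section of the quotient map with s(1)=1. Let α ∈ Z²(G,A) satisfy ∏_{n∈N} α(n,σ) ∈ A^N for all σ ∈ G. Then AW²(α), viewed as a function on (G/N) × (G/N), takes values in A^N, is a 2-cocycle in Z²(G/N, A^N), and is cohomologous in Z²(G/N, A^N) to the Akizuki–Witt cocycle AW~(α): there exists b : G/N → A^N such that AW²(α)(σ,τ) = AW~(α)(σ,τ) · b(σ)·σ(b(τ))·b(στ)⁻¹ for all σ,τ ∈ G/N. -/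
section AkizukiWitt

variable {G : Type*} [Group G] (N : Subgroup G) {A : Type*} [CommGroup A]

section Invariant

variable [MulDistribMulAction G A]

theorem smul_smul_eq_of_invariant [N.Normal] {a : A} (ha : ∀ m : N, (m : G) • a = a)
    (σ : G) (m : N) : (m : G) • σ • a = σ • a := by
  have h := ha (MulAut.conjNormal σ⁻¹ m)
  rw [MulAut.conjNormal_apply, inv_inv] at h
  conv_rhs => rw [← h]
  simp [smul_smul, mul_assoc]

theorem smul_eq_smul_of_mk_eq {a : A} (ha : ∀ m : N, (m : G) • a = a) {σ σ' : G}
    (h : (σ : G ⧸ N) = σ') : σ • a = σ' • a := by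
  have h1 := ha ⟨σ⁻¹ * σ', QuotientGroup.eq.1 h⟩
  conv_lhs => rw [← h1]
  simp [smul_smul]

end Invariant

variable [Fintype N]

/-- The product `∏_{n ∈ N} α(n, σ)`. -/
def leftCosetProd (α : G → G → A) (σ : G) : A := ∏ n : N, α (n : G) σ

/-- The map `AW²(α)`, as a function of two elements of `G`. -/
def akizukiWittTwo (α : G → G → A) (σ τ : G) : A :=
  ∏ n : N, α σ ((n : G) * τ) / α σ (n : G)

/-- The norm `a ↦ ∏_{n ∈ N} n • a`. -/
def subgroupNorm [MulDistribMulAction G A] (a : A) : A := ∏ n : N, (n : G) • a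

theorem prod_mul_right_eq_prod_mul_left [N.Normal] (f : G → A) (σ : G) :
    ∏ n : N, f (σ * n) = ∏ n : N, f (n * σ) := by
  refine Fintype.prod_equiv (MulAut.conjNormal σ).toEquiv _ _ fun n => ?_
  simp

theorem prod_mem_mul_right (f : G → A) (m : N) : ∏ n : N, f (n * m) = ∏ n : N, f n :=
  Fintype.prod_equiv (Equiv.mulRight m) _ _ fun n => by simp

theorem prod_mem_mul_left (f : G → A) (m : N) : ∏ n : N, f (m * n) = ∏ n : N, f n :=
  Fintype.prod_equiv (Equiv.mulLeft m) _ _ fun n => by simp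

variable [MulDistribMulAction G A]

theorem smul_subgroupNorm [N.Normal] (σ : G) (a : A) :
    σ • subgroupNorm N a = subgroupNorm N (σ • a) := by
  simp only [subgroupNorm, Finset.smul_prod', smul_smul]
  exact prod_mul_right_eq_prod_mul_left N (fun g => g • a) σ

theorem mem_smul_subgroupNorm (m : N) (a : A) :
    (m : G) • subgroupNorm N a = subgroupNorm N a := by
  simp only [subgroupNorm, Finset.smul_prod', smul_smul]
  exact prod_mem_mul_left N (fun g => g • a) m

theorem subgroupNorm_mul (a b : A) :
    subgroupNorm N (a * b) = subgroupNorm N a * subgroupNorm N b := by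
  simp [subgroupNorm, Finset.prod_mul_distrib]

variable {α : G → G → A}

theorem akizukiWittTwo_mul_smul [N.Normal]
    (hα : ∀ σ τ υ : G, σ • α τ υ * α σ (τ * υ) = α (σ * τ) υ * α σ τ) (σ τ : G) :
    akizukiWittTwo N α σ τ = (∏ n : N, α (σ * n) τ) / σ • leftCosetProd N α τ := by
  rw [akizukiWittTwo, leftCosetProd, Finset.smul_prod', ← Finset.prod_div_distrib]
  refine Finset.prod_congr rfl fun n _ => ?_
  rw [div_eq_div_iff_mul_eq_mul, mul_comm, hα]

theorem akizukiWittTwo_eq [N.Normal]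
    (hα : ∀ σ τ υ : G, σ • α τ υ * α σ (τ * υ) = α (σ * τ) υ * α σ τ) (σ τ : G) :
    akizukiWittTwo N α σ τ =
      subgroupNorm N (α σ τ) * leftCosetProd N α (σ * τ) /
        (leftCosetProd N α σ * σ • leftCosetProd N α τ) := by
  rw [akizukiWittTwo_mul_smul N hα, prod_mul_right_eq_prod_mul_left N (fun g => α g τ),
    ← div_div]
  congr 1
  simp only [subgroupNorm, leftCosetProd, ← Finset.prod_mul_distrib, ← Finset.prod_div_distrib]
  refine Finset.prod_congr rfl fun n _ => ?_
  rw [eq_div_iff_mul_eq', hα, mul_comm]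

theorem akizukiWittTwo_cocycle [N.Normal]
    (hα : ∀ σ τ υ : G, σ • α τ υ * α σ (τ * υ) = α (σ * τ) υ * α σ τ) (σ τ υ : G) :
    σ • akizukiWittTwo N α τ υ * akizukiWittTwo N α σ (τ * υ) =
      akizukiWittTwo N α (σ * τ) υ * akizukiWittTwo N α σ τ := by
  have h := congrArg (subgroupNorm N) (hα σ τ υ)
  rw [subgroupNorm_mul, subgroupNorm_mul, ← smul_subgroupNorm] at h
  simp only [akizukiWittTwo_eq N hα, smul_mul', smul_div', smul_smul, mul_assoc σ τ υ]
  rw [← eq_div_iff_mul_eq'] at h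
  rw [h]
  simp only [div_eq_mul_inv, mul_inv]
  generalize leftCosetProd N α (σ * (τ * υ)) = p
  generalize σ • leftCosetProd N α (τ * υ) = q
  generalize leftCosetProd N α (σ * τ) = r
  generalize σ • leftCosetProd N α τ = t
  generalize (σ * τ) • leftCosetProd N α υ = u
  apply Additive.ofMul.injective
  simp only [ofMul_mul, ofMul_inv]
  abel

theorem mem_smul_akizukiWittTwo [N.Normal]
    (hα : ∀ σ τ υ : G, σ • α τ υ * α σ (τ * υ) = α (σ * τ) υ * α σ τ)
    (hinv : ∀ (σ : G) (m : N), (m : G) • leftCosetProd N α σ = leftCosetProd N α σ)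
    (σ τ : G) (m : N) :
    (m : G) • akizukiWittTwo N α σ τ = akizukiWittTwo N α σ τ := by
  rw [akizukiWittTwo_eq N hα, smul_div', smul_mul', smul_mul', mem_smul_subgroupNorm,
    hinv, hinv, smul_smul_eq_of_invariant N (hinv τ)]

theorem akizukiWittTwo_congr [N.Normal]
    (hα : ∀ σ τ υ : G, σ • α τ υ * α σ (τ * υ) = α (σ * τ) υ * α σ τ)
    (hinv : ∀ (σ : G) (m : N), (m : G) • leftCosetProd N α σ = leftCosetProd N α σ)
    {σ σ' τ τ' : G} (h : (σ : G ⧸ N) = σ') (h' : (τ : G ⧸ N) = τ') :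
    akizukiWittTwo N α σ τ = akizukiWittTwo N α σ' τ' := by
  trans akizukiWittTwo N α σ' τ
  · rw [akizukiWittTwo_mul_smul N hα, akizukiWittTwo_mul_smul N hα,
      smul_eq_smul_of_mk_eq N (hinv τ) h]
    congr 1
    have key := prod_mem_mul_left N (fun g => α (σ * g) τ) ⟨σ⁻¹ * σ', QuotientGroup.eq.1 h⟩
    rw [← key]
    simp [mul_assoc]
  · have hm : τ' * τ⁻¹ ∈ N :=
      (inferInstance : N.Normal).mem_comm (QuotientGroup.eq.1 h')
    have key := prod_mem_mul_right N (fun g => α σ' (g * τ)) ⟨τ' * τ⁻¹, hm⟩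
    simp only [akizukiWittTwo, Finset.prod_div_distrib]
    rw [← key]
    simp [mul_assoc]

end AkizukiWitt


/-- If `α ∈ Z²(G,A)` satisfies `∏_{n∈N} α(n,σ) ∈ A^N` for all `σ`, then
`AW²(α)` viewed as a function on `(G/N) × (G/N)` (via a lift `L`) takes values in
`A^N`, is a 2-cocycle in `Z²(G/N, A^N)`, and differs from the Akizuki–Witt cocycle
`AW~(α)` (defined via a section `s` with `s 1 = 1`) by the coboundary of a
1-cochain `b : G/N → A^N`. -/
theorem AW2_is_cocycle_cohomologous_AWtilde {G : Type*} [Group G] [Fintype G]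
    (N : Subgroup G) [N.Normal] [Fintype N]
    {A : Type*} [CommGroup A] [MulDistribMulAction G A]
    (s : G ⧸ N → G) (hs : ∀ x : G ⧸ N, ((s x : G) : G ⧸ N) = x) (hs1 : s 1 = 1)
    (L : G ⧸ N → G) (hL : ∀ q : G ⧸ N, ((L q : G) : G ⧸ N) = q)
    (α : G → G → A)
    (hα : ∀ σ τ υ : G, σ • α τ υ * α σ (τ * υ) = α (σ * τ) υ * α σ τ)
    (hα3 : ∀ σ : G, ∀ m : N,
      (m : G) • (∏ n : N, α (n : G) σ) = ∏ n : N, α (n : G) σ) :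
    -- values in `A^N`
    (∀ (σ τ : G ⧸ N) (m : N),
        (m : G) • (∏ n : N, α (L σ) ((n : G) * L τ) / α (L σ) (n : G))
          = ∏ n : N, α (L σ) ((n : G) * L τ) / α (L σ) (n : G)) ∧
    -- 2-cocycle condition on `G/N` (the `G/N`-action on `A^N` computed via lifts)
    (∀ σ τ υ : G ⧸ N,
        L σ • (∏ n : N, α (L τ) ((n : G) * L υ) / α (L τ) (n : G))
            * (∏ n : N, α (L σ) ((n : G) * L (τ * υ)) / α (L σ) (n : G))
          = (∏ n : N, α (L (σ * τ)) ((n : G) * L υ) / α (L (σ * τ)) (n : G))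
            * (∏ n : N, α (L σ) ((n : G) * L τ) / α (L σ) (n : G))) ∧
    -- cohomologous to the Akizuki–Witt cocycle `AW~(α)`
    (∃ b : G ⧸ N → A, (∀ (x : G ⧸ N) (m : N), (m : G) • b x = b x) ∧
        ∀ σ τ : G ⧸ N,
          (∏ n : N, α (L σ) ((n : G) * L τ) / α (L σ) (n : G))
            = (∏ n : N,
                (n : G) • α (s σ) (s τ) * α (n : G) (s σ * s τ) / α (n : G) (s (σ * τ)))
              * (b σ * L σ • b τ * (b (σ * τ))⁻¹)) := by
  have hLmul (σ τ : G ⧸ N) : ((L (σ * τ) : G) : G ⧸ N) = (L σ * L τ : G) := by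
    rw [QuotientGroup.mk_mul, hL, hL, hL]
  refine ⟨fun σ τ => mem_smul_akizukiWittTwo N hα hα3 (L σ) (L τ), fun σ τ υ => ?_,
    fun x => (leftCosetProd N α (s x))⁻¹, fun x m => ?_, fun σ τ => ?_⟩
  · have h := akizukiWittTwo_cocycle N hα (L σ) (L τ) (L υ)
    rw [← akizukiWittTwo_congr N hα hα3 rfl (hLmul τ υ),
      ← akizukiWittTwo_congr N hα hα3 (hLmul σ τ) rfl] at h
    exact h
  · rw [smul_inv']
    exact congrArg _ (hα3 (s x) m)
  · have hls (x : G ⧸ N) : ((L x : G) : G ⧸ N) = s x := (hL x).trans (hs x).symm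
    have h := akizukiWittTwo_congr N hα hα3 (hls σ) (hls τ)
    rw [akizukiWittTwo_eq N hα (s σ)] at h
    refine h.trans ?_
    rw [Finset.prod_div_distrib, Finset.prod_mul_distrib, smul_inv',
      smul_eq_smul_of_mk_eq N (a := leftCosetProd N α (s τ)) (hα3 (s τ)) (hls σ)]
    change _ = subgroupNorm N _ * leftCosetProd N α _ / leftCosetProd N α _ * _
    simp only [div_eq_mul_inv, mul_inv, inv_inv]
    rw [mul_assoc (_ * _) _⁻¹, mul_comm _⁻¹ (_ * _ * _), mul_inv_cancel_right]
end

section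
/- Let G be a finite group and N a normal subgroup of G. Let Γ be a group equipped with a surjective homomorphism π : Γ → G, and let A be a Γ-module. Then for every map β : G → A one has the equality d(AW¹(β)) = AW²(d(β)) of maps Γ × G/N → A, where d(β) : Γ × G → A is given by d(β)(σ,τ) = β(π(σ)) · σ(β(τ)) · β(π(σ)τ)⁻¹, and d(AW¹(β)) : Γ × G/N → A is given by d(AW¹(β))(σ,τ) = AW¹(β)(σ̄) · σ(AW¹(β)(τ)) · AW¹(β)(σ̄τ)⁻¹, with σ̄ the image of σ in G/N. -/
/-- The product of `β` over the coset `s N t` only depends on the class of `s * t` modulo `N`. -/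
theorem prod_normal_mul_eq_of_mk_eq {G A : Type*} [Group G] (N : Subgroup G) [N.Normal]
    [Fintype N] [CommMonoid A] (β : G → A) {s t u : G} (h : ((s * t : G) : G ⧸ N) = u) :
    ∏ n : N, β (s * ((n : G) * t)) = ∏ n : N, β ((n : G) * u) := by
  have hk : s * t * u⁻¹ ∈ N := by
    rw [← QuotientGroup.eq_one_iff, QuotientGroup.mk_mul, h, ← QuotientGroup.mk_mul,
      mul_inv_cancel, QuotientGroup.mk_one]
  refine Fintype.prod_equiv
    ((MulAut.conjNormal s).toEquiv.trans (Equiv.mulRight (⟨s * t * u⁻¹, hk⟩ : N))) _ _ fun n => ?_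
  congr 1
  simp [mul_assoc]

/-- For `Γ` surjecting onto `G` via `π`, `A` a `Γ`-module and any
`β : G → A`, one has `d(AW¹(β)) = AW²(d(β))` as maps `Γ × G/N → A`, where
`AW¹(β)(σ) = ∏_{n∈N} β(n σ̃)/β(n)` (lift `σ̃ = L σ`),
`d(β)(σ,τ) = β(π σ) · σ•β(τ) · β(π σ · τ)⁻¹`, and
`AW²(γ)(σ,τ) = ∏_{n∈N} γ(σ, n τ̃)/γ(σ, n)`. -/
theorem dAW1_eq_AW2d {G Γ A : Type*} [Group G] [Fintype G]
    (N : Subgroup G) [N.Normal] [Fintype N]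
    [Group Γ] [CommGroup A] [MulDistribMulAction Γ A]
    (π : Γ →* G) (hπ : Function.Surjective π)
    (L : G ⧸ N → G) (hL : ∀ q : G ⧸ N, ((L q : G) : G ⧸ N) = q)
    (β : G → A) :
    ∀ (σ : Γ) (τ : G ⧸ N),
      (∏ n : N,
          (β (π σ) * σ • β ((n : G) * L τ) * (β (π σ * ((n : G) * L τ)))⁻¹) /
            (β (π σ) * σ • β (n : G) * (β (π σ * (n : G)))⁻¹))
        = (∏ n : N, β ((n : G) * L ((π σ : G ⧸ N))) / β (n : G))
            * σ • (∏ n : N, β ((n : G) * L τ) / β (n : G))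
            * (∏ n : N, β ((n : G) * L (((π σ : G ⧸ N)) * τ)) / β (n : G))⁻¹ := by
  intro σ τ
  have h₁ : ∏ n : N, β (π σ * ((n : G) * L τ)) =
      ∏ n : N, β ((n : G) * L ((π σ : G ⧸ N) * τ)) :=
    prod_normal_mul_eq_of_mk_eq N β (by rw [QuotientGroup.mk_mul, hL, hL])
  have h₂ : ∏ n : N, β (π σ * (n : G)) = ∏ n : N, β ((n : G) * L (π σ : G ⧸ N)) := by
    simpa using prod_normal_mul_eq_of_mk_eq N β (s := π σ) (t := 1) (u := L (π σ : G ⧸ N))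
      (by rw [mul_one, hL])
  have h₃ (a b c d e : A) : a * b * c⁻¹ / (a * d * e⁻¹) = b / d * (e / c) := by
    rw [mul_assoc, mul_assoc, mul_div_mul_left_eq_div, mul_div_mul_comm, inv_div_inv]
  have h₄ : σ • ∏ n : N, β ((n : G) * L τ) / β (n : G) =
      ∏ n : N, σ • β ((n : G) * L τ) / σ • β (n : G) := by
    rw [← MulDistribMulAction.toMonoidHom_apply, map_prod]
    simp only [MulDistribMulAction.toMonoidHom_apply, smul_div']
  rw [h₄, Finset.prod_congr rfl fun n _ => h₃ _ _ _ _ _, Finset.prod_mul_distrib,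
    Finset.prod_div_distrib (f := fun n : N => β (π σ * (n : G))), h₁, h₂,
    Finset.prod_div_distrib (f := fun n : N => β ((n : G) * L (π σ : G ⧸ N))),
    Finset.prod_div_distrib (f := fun n : N => β ((n : G) * L ((π σ : G ⧸ N) * τ))),
    mul_right_comm, inv_div, div_mul_div_cancel, mul_comm]
end

section
/- Let G be a finite group, N a normal subgroup of G, and A an abelian group (written multiplicatively). The map AW¹, restricted to the set of maps β : G → A with β(1)=1, is surjective onto the set of maps β' : G/N → A with β'(1)=1. -/
/-- The map `AW¹` (computed with a fixed choice of lifts `L`, on which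
it does not depend), restricted to maps `β : G → A` with `β 1 = 1`, is surjective
onto the maps `β' : G/N → A` with `β' 1 = 1`. -/
theorem AW1_surjective {G A : Type*} [Group G] [Fintype G]
    (N : Subgroup G) [N.Normal] [Fintype N] [CommGroup A]
    (L : G ⧸ N → G) (hL : ∀ q : G ⧸ N, ((L q : G) : G ⧸ N) = q)
    (β' : G ⧸ N → A) (hβ' : β' 1 = 1) :
    ∃ β : G → A, β 1 = 1 ∧
      ∀ σ : G ⧸ N, (∏ n : N, β ((n : G) * L σ) / β (n : G)) = β' σ := by
  classical
  refine ⟨fun g => if g = L g then β' g else 1, ?_, fun σ => ?_⟩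
  · simp [hβ']
  · have coe_one (n : N) : ((n : G) : G ⧸ N) = 1 := (QuotientGroup.eq_one_iff _).2 n.2
    have coe_mul (n : N) : (((n : G) * L σ : G) : G ⧸ N) = σ := by
      rw [QuotientGroup.mk_mul, coe_one, one_mul, hL]
    simp [-QuotientGroup.mk_mul, coe_one, coe_mul, hβ']
end

section
/- Let G be a finite group, N a normal subgroup of G, Γ a group equipped with a surjective homomorphism onto G, and A an abelian group (written multiplicatively). The map AW², restricted to the set of maps α : Γ × G → A with α(σ,1)=1 for all σ ∈ Γ, is surjective onto the set of maps α' : Γ × G/N → A with α'(σ,1)=1 for all σ ∈ Γ. -/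
/-- For `Γ` surjecting onto `G`, the map `AW²` (computed with a fixed
choice of lifts `L`, on which it does not depend), restricted to maps
`α : Γ × G → A` with `α(σ,1) = 1` for all `σ`, is surjective onto the maps
`α' : Γ × G/N → A` with `α'(σ,1) = 1` for all `σ`. -/
theorem AW2_surjective {G Γ A : Type*} [Group G] [Fintype G]
    (N : Subgroup G) [N.Normal] [Fintype N]
    [Group Γ] [CommGroup A]
    (π : Γ →* G) (hπ : Function.Surjective π)
    (L : G ⧸ N → G) (hL : ∀ q : G ⧸ N, ((L q : G) : G ⧸ N) = q)
    (α' : Γ → G ⧸ N → A) (hα' : ∀ σ : Γ, α' σ 1 = 1) :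
    ∃ α : Γ → G → A, (∀ σ : Γ, α σ 1 = 1) ∧
      ∀ (σ : Γ) (τ : G ⧸ N),
        (∏ n : N, α σ ((n : G) * L τ) / α σ (n : G)) = α' σ τ := by
  classical
  refine ⟨fun σ g => if g = L (g : G ⧸ N) then α' σ (g : G ⧸ N) else 1, fun σ => ?_,
    fun σ τ => ?_⟩
  · simp [hα']
  · have hn (n : N) : ((n : G) : G ⧸ N) = 1 := (QuotientGroup.eq_one_iff _).2 n.2
    have hm (n : N) : (((n : G) * L τ : G) : G ⧸ N) = τ := by
      rw [QuotientGroup.mk_mul, hn, hL, one_mul]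
    simp only [hn, hm, hα', ite_self, div_one, mul_eq_right, OneMemClass.coe_eq_one]
    simp
end

section
/- Let G be a finite group, N a normal subgroup of G, A a G-module, and s : G/N → G a section of the quotient map with s(1)=1. Let α₀ ∈ Z²(G,A), and let α_N ∈ Z²(G/N, A^N) be a 2-cocycle with α_N(1,1)=1 which is cohomologous in Z²(G/N, A^N) to AW~(α₀), i.e. α_N = AW~(α₀)·db for some b : G/N → A^N. Then there exists α ∈ Z²(G,A) cohomologous to α₀ such that α(1,1)=1 and AW²(α)(σ,τ) = α_N(σ̄, τ) for all σ ∈ G and τ ∈ G/N, where σ̄ is the image of σ in G/N. -/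
namespace Subgroup

variable {G M : Type*} [Group G] [CommMonoid M] (N : Subgroup G) [N.Normal] [Fintype N]

/-- The product of `f` over a coset of `N` does not depend on the representative. -/
theorem prod_mul_right_eq_of_mk_eq (f : G → M) {g h : G} (hgh : (g : G ⧸ N) = h) :
    ∏ n : N, f (n * g) = ∏ n : N, f (n * h) := by
  have hmem : g * h⁻¹ ∈ N := by
    rw [← QuotientGroup.eq_one_iff, QuotientGroup.mk_mul, QuotientGroup.mk_inv, hgh,
      mul_inv_cancel]
  refine Fintype.prod_equiv (Equiv.mulRight ⟨g * h⁻¹, hmem⟩) _ _ fun n => ?_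
  simp [mul_assoc]

/-- The product of `f` over a left coset of the normal subgroup `N`, translated by `h`, is its
product over the corresponding right coset. -/
theorem prod_mul_left_mul_eq (f : G → M) (g h : G) :
    ∏ n : N, f (g * (n * h)) = ∏ n : N, f (n * (g * h)) := by
  refine Fintype.prod_equiv (MulAut.conjNormal g).toEquiv _ _ fun n => ?_
  simp [mul_assoc]

/-- Any function on `G ⧸ N` is obtained by multiplying some function on `G`, with prescribed
values on a set of coset representatives, over the cosets of `N`. -/
theorem exists_prod_mul_right_eq (s : G ⧸ N → G) (hs : ∀ x : G ⧸ N, ((s x : G) : G ⧸ N) = x)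
    (B : G ⧸ N → M) :
    ∃ β : G → M, (∀ g : G, ∏ n : N, β (n * g) = B g) ∧ ∀ q, β (s q) = B q := by
  classical
  refine ⟨fun x => if x = s x then B x else 1, fun g => ?_, fun q => by simp [hs]⟩
  refine (N.prod_mul_right_eq_of_mk_eq (fun x => if x = s x then B x else 1)
    (hs g).symm).trans ?_
  rw [Fintype.prod_eq_single 1]
  · simp [hs]
  · intro n hn
    have hq : (((n : G) * s g : G) : G ⧸ N) = g := by
      rw [QuotientGroup.mk_mul, hs, (QuotientGroup.eq_one_iff (n : G)).2 n.2, one_mul]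
    simp [hq, hn]

end Subgroup

section AkizukiWitt

variable {G A : Type*} [Group G] [CommGroup A] [MulDistribMulAction G A]
  (N : Subgroup G) [Fintype N] {α : G → G → A}

/-- The product over `N` of the cocycle identities for the triples `(n, g, x)`. -/
theorem prod_mul_prod_eq
    (hα : ∀ σ τ υ : G, σ • α τ υ * α σ (τ * υ) = α (σ * τ) υ * α σ τ) (g x : G) :
    (∏ n : N, α (n * g) x) * ∏ n : N, α n g = ∏ n : N, (n : G) • α g x * α n (g * x) := by
  rw [← Finset.prod_mul_distrib]
  exact Finset.prod_congr rfl fun n _ => (hα n g x).symm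

variable [N.Normal]

/-- `AW²(α)(g, x)` times `g` applied to `∏ n, α n x` is the product of `α · x` over the coset
of `g`. -/
theorem prod_div_mul_smul_prod_eq
    (hα : ∀ σ τ υ : G, σ • α τ υ * α σ (τ * υ) = α (σ * τ) υ * α σ τ) (g x : G) :
    (∏ n : N, α g (n * x) / α g n) * g • ∏ n : N, α n x = ∏ n : N, α (n * g) x := by
  have h := N.prod_mul_left_mul_eq (fun y => α y x) g 1
  simp only [mul_one] at h
  rw [← h, Finset.smul_prod', ← Finset.prod_mul_distrib]
  refine Finset.prod_congr rfl fun n _ => ?_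
  rw [div_mul_eq_mul_div, div_eq_iff_eq_mul, mul_comm, hα]

/-- The Akizuki–Witt cocycle `AW~(α)` at the images of `g` and `l` in `G ⧸ N` differs from
`AW²(α)` by the coboundary of `q ↦ ∏ n, α n (s q)`. -/
theorem prod_div_mul_coboundary_eq
    (hα : ∀ σ τ υ : G, σ • α τ υ * α σ (τ * υ) = α (σ * τ) υ * α σ τ)
    (s : G ⧸ N → G) (hs : ∀ x : G ⧸ N, ((s x : G) : G ⧸ N) = x)
    {g l : G} {τ : G ⧸ N} (hl : (l : G ⧸ N) = τ) :
    (∏ n : N, α g (n * l) / α g n) *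
        (g • (∏ n : N, α n (s τ)) * (∏ n : N, α n (s g)) / ∏ n : N, α n (s (g * τ))) =
      ∏ n : N, (n : G) • α (s g) (s τ) * α n (s g * s τ) / α n (s (g * τ)) := by
  have h₁ : ∏ n : N, α g (n * l) / α g n = ∏ n : N, α g (n * s τ) / α g n := by
    rw [Finset.prod_div_distrib, Finset.prod_div_distrib,
      N.prod_mul_right_eq_of_mk_eq (α g) (hl.trans (hs τ).symm)]
  rw [h₁, ← mul_div_assoc, ← mul_assoc, prod_div_mul_smul_prod_eq N hα,
    N.prod_mul_right_eq_of_mk_eq (fun y => α y (s τ)) (hs g).symm, prod_mul_prod_eq N hα,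
    Finset.prod_div_distrib]

/-- `AW²` of the coboundary of `β`, in terms of the products of `β` over the cosets of `N`. -/
theorem prod_coboundary_div_eq (β : G → A) {B : G ⧸ N → A}
    (hB : ∀ g : G, ∏ n : N, β (n * g) = B g) (g l : G) :
    ∏ n : N, (β g * g • β (n * l) * (β (g * (n * l)))⁻¹) /
        (β g * g • β n * (β (g * n))⁻¹) =
      g • (B l / B 1) * B g / B (g * l) := by
  have h₁ := N.prod_mul_left_mul_eq β g l
  have h₂ := N.prod_mul_left_mul_eq β g 1
  have h₃ := hB 1
  simp only [mul_one, QuotientGroup.mk_one] at h₂ h₃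
  simp only [Finset.prod_div_distrib, Finset.prod_mul_distrib, Finset.prod_inv_distrib,
    ← Finset.smul_prod', h₁, h₂, h₃, hB, smul_div', QuotientGroup.mk_mul]
  rw [mul_assoc, mul_assoc, mul_div_mul_left_eq_div, div_eq_mul_inv, mul_inv, inv_inv,
    div_eq_mul_inv, div_eq_mul_inv]
  ac_rfl

end AkizukiWitt

/-- Let `α₀ ∈ Z²(G,A)`, and let `αN ∈ Z²(G/N, A^N)` with
`αN(1,1) = 1` be cohomologous to the Akizuki–Witt cocycle `AW~(α₀)`, i.e.
`αN = AW~(α₀) · db` for a 1-cochain `b` with values in `A^N`. Then there is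
a 1-cochain `β : G → A` such that the cohomologous cocycle `α = α₀ · dβ`
satisfies `α(1,1) = 1` and `AW²(α)(σ,τ) = αN(σ̄, τ)` for all `σ ∈ G`,
`τ ∈ G/N`. -/
theorem exists_cocycle_mapping_to_given_AW {G A : Type*} [Group G] [Fintype G]
    (N : Subgroup G) [N.Normal] [Fintype N]
    [CommGroup A] [MulDistribMulAction G A]
    (s : G ⧸ N → G) (hs : ∀ x : G ⧸ N, ((s x : G) : G ⧸ N) = x) (hs1 : s 1 = 1)
    (L : G ⧸ N → G) (hL : ∀ q : G ⧸ N, ((L q : G) : G ⧸ N) = q)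
    (α₀ : G → G → A)
    (hα₀ : ∀ σ τ υ : G, σ • α₀ τ υ * α₀ σ (τ * υ) = α₀ (σ * τ) υ * α₀ σ τ)
    (αN : G ⧸ N → G ⧸ N → A)
    -- `αN` takes values in `A^N`
    (hαNval : ∀ (σ τ : G ⧸ N) (m : N), (m : G) • αN σ τ = αN σ τ)
    -- `αN` is a 2-cocycle of `G/N` with values in `A^N` (action via lifts)
    (hαNcoc : ∀ σ τ υ : G ⧸ N,
      L σ • αN τ υ * αN σ (τ * υ) = αN (σ * τ) υ * αN σ τ)
    (hαN11 : αN 1 1 = 1)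
    -- `αN` is cohomologous to `AW~(α₀)` via a 1-cochain `b` valued in `A^N`
    (b : G ⧸ N → A) (hbinv : ∀ (x : G ⧸ N) (m : N), (m : G) • b x = b x)
    (hαN : ∀ σ τ : G ⧸ N, αN σ τ =
      (∏ n : N,
          (n : G) • α₀ (s σ) (s τ) * α₀ (n : G) (s σ * s τ) / α₀ (n : G) (s (σ * τ)))
        * (b σ * L σ • b τ * (b (σ * τ))⁻¹)) :
    ∃ β : G → A,
      -- `α := α₀ · dβ` satisfies `α 1 1 = 1`
      α₀ 1 1 * (β 1 * (1 : G) • β 1 * (β 1)⁻¹) = 1 ∧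
      -- and `AW²(α)(σ, τ) = αN(σ̄, τ)`
      ∀ (σ : G) (τ : G ⧸ N),
        (∏ n : N,
            (α₀ σ ((n : G) * L τ)
                * (β σ * σ • β ((n : G) * L τ) * (β (σ * ((n : G) * L τ)))⁻¹)) /
              (α₀ σ (n : G) * (β σ * σ • β (n : G) * (β (σ * (n : G)))⁻¹)))
          = αN ((σ : G ⧸ N)) τ := by
  set C : G ⧸ N → A := fun q => (∏ n : N, α₀ n (s q)) * b q with hC
  have hb (g : G) (τ : G ⧸ N) : L g • b τ = g • b τ := by
    have hm : g⁻¹ * L g ∈ N := QuotientGroup.eq.1 (hL g).symm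
    rw [← mul_inv_cancel_left g (L g), mul_smul, hbinv τ ⟨_, hm⟩]
  have key (g l : G) : (∏ n : N, α₀ g (n * l) / α₀ g n) * (g • C l * C g / C (g * l)) =
      αN g l := by
    rw [hαN, hb, ← prod_div_mul_coboundary_eq N hα₀ s hs (g := g) (l := l) rfl, hC]
    simp only [smul_mul']
    rw [mul_mul_mul_comm, mul_div_mul_comm, ← mul_assoc, mul_comm (b g), div_eq_mul_inv (_ * b g)]
  have hone (x : G) : α₀ 1 x = α₀ 1 1 := by
    simpa using hα₀ 1 1 x
  have hC1 : C 1 = 1 := by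
    have h := key 1 1
    simpa [hone, hαN11] using h
  set B : G ⧸ N → A := fun q => C q * (α₀ 1 1)⁻¹ with hBdef
  obtain ⟨β, hβ, hβs⟩ := N.exists_prod_mul_right_eq s hs B
  refine ⟨β, ?_, fun g τ => ?_⟩
  · have hβ1 := hβs 1
    rw [hs1] at hβ1
    simp [hβ1, hBdef, hC1]
  · have hk := key g (L τ)
    simp_rw [mul_div_mul_comm (α₀ g _)]
    rw [Finset.prod_mul_distrib, prod_coboundary_div_eq N β hβ g (L τ)]
    rw [hL] at hk ⊢
    rw [← hk, hBdef]
    simp only [← mul_assoc, mul_div_mul_right_eq_div, hC1, div_one]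
end

section
/- Let G be a finite group, N a normal subgroup of G, A a G-module, and s : G/N → G a section of the quotient map with s(1)=1. Let α, α' ∈ Z²(G,A) be cohomologous 2-cocycles both satisfying α(n, s(σ)) = 1 = α'(n, s(σ)) for all n ∈ N and σ ∈ G/N. Then the quotient AW²(α)/AW²(α'), viewed as a 2-cocycle on G/N with values in A^N, is the coboundary of a 1-cochain with values in N_N(A) := { ∏_{n∈N} n(x) : x ∈ A }: there exists b : G/N → N_N(A) such that AW²(α)(σ,τ)/AW²(α')(σ,τ) = b(σ)·σ(b(τ))·b(στ)⁻¹ for all σ,τ ∈ G/N. -/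
/-- A translate `g * N * h` is the coset `N * u` as soon as `g * h ≡ u` modulo `N`. -/
theorem prod_mul_mul_eq_prod_mul_of_mk_eq {G A : Type*} [Group G] (N : Subgroup G) [N.Normal]
    [Fintype N] [CommMonoid A] (f : G → A) (g h u : G)
    (hu : (g : G ⧸ N) * (h : G ⧸ N) = (u : G ⧸ N)) :
    ∏ n : N, f (g * n * h) = ∏ n : N, f (n * u) := by
  have hmem (n : N) : g * n * h * u⁻¹ ∈ N := by
    rw [← QuotientGroup.eq_one_iff]
    simp [hu]
  have hinj : Function.Injective fun n : N => (⟨g * n * h * u⁻¹, hmem n⟩ : N) := by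
    intro m n hmn
    simpa using hmn
  refine Fintype.prod_bijective _ (Finite.injective_iff_bijective.1 hinj) _ _ fun n => ?_
  simp


/-- If `α, α' ∈ Z²(G,A)` are cohomologous 2-cocycles satisfying
`α(n, s σ) = 1 = α'(n, s σ)` for all `n ∈ N`, `σ ∈ G/N` (for a section `s` with
`s 1 = 1`), then the quotient `AW²(α)/AW²(α')`, viewed as a 2-cocycle on `G/N`
(first argument lifted via `s`), is the coboundary of a 1-cochain with values in
`N_N(A) = { ∏_{n∈N} n(x) | x ∈ A }`. -/
theorem AW2_quotient_is_coboundary_in_norms {G A : Type*} [Group G] [Fintype G]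
    (N : Subgroup G) [N.Normal] [Fintype N]
    [CommGroup A] [MulDistribMulAction G A]
    (s : G ⧸ N → G) (hs : ∀ x : G ⧸ N, ((s x : G) : G ⧸ N) = x) (hs1 : s 1 = 1)
    (α α' : G → G → A)
    (hα : ∀ σ τ υ : G, σ • α τ υ * α σ (τ * υ) = α (σ * τ) υ * α σ τ)
    (hα' : ∀ σ τ υ : G, σ • α' τ υ * α' σ (τ * υ) = α' (σ * τ) υ * α' σ τ)
    (hcoh : ∃ c : G → A, ∀ σ τ : G,
      α' σ τ = α σ τ * (c σ * σ • c τ * (c (σ * τ))⁻¹))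
    (hvan : ∀ (n : N) (σ : G ⧸ N), α (n : G) (s σ) = 1)
    (hvan' : ∀ (n : N) (σ : G ⧸ N), α' (n : G) (s σ) = 1) :
    ∃ b : G ⧸ N → A,
      (∀ x : G ⧸ N, ∃ a : A, b x = ∏ n : N, (n : G) • a) ∧
      ∀ σ τ : G ⧸ N,
        (∏ n : N, α (s σ) ((n : G) * s τ) / α (s σ) (n : G)) /
            (∏ n : N, α' (s σ) ((n : G) * s τ) / α' (s σ) (n : G))
          = b σ * s σ • b τ * (b (σ * τ))⁻¹ := by
  obtain ⟨c, hc⟩ := hcoh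
  have hmul (n : N) (x : G ⧸ N) : c (n * s x) = c n * (n : G) • c (s x) := by
    have h := hc n (s x)
    rw [hvan, hvan', one_mul] at h
    exact (mul_inv_eq_one.1 h.symm).symm
  have hcoset (g h : G) (x : G ⧸ N) (hx : (g : G ⧸ N) * (h : G ⧸ N) = x) :
      ∏ n : N, c (g * n * h) = (∏ n : N, c n) * ∏ n : N, (n : G) • c (s x) := by
    rw [prod_mul_mul_eq_prod_mul_of_mk_eq N c g h (s x) (hx.trans (hs x).symm),
      ← Finset.prod_mul_distrib]
    exact Finset.prod_congr rfl fun n _ => hmul n x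
  refine ⟨fun x => ∏ n : N, (n : G) • (c (s x))⁻¹, fun x => ⟨_, rfl⟩, fun σ τ => ?_⟩
  have hterm (n : N) : α (s σ) (n * s τ) / α (s σ) n / (α' (s σ) (n * s τ) / α' (s σ) n) =
      (s σ • (n : G) • c (s τ))⁻¹ * (c (s σ * n * s τ) / c (s σ * n * 1)) := by
    rw [hc, hc, hmul, smul_mul', ← mul_assoc (s σ), mul_one]
    simp only [div_eq_mul_inv, mul_inv_rev, inv_inv]
    apply Additive.ofMul.injective
    simp only [ofMul_mul, ofMul_inv]
    abel
  rw [← Finset.prod_div_distrib, Finset.prod_congr rfl fun n _ => hterm n,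
    Finset.prod_mul_distrib, Finset.prod_div_distrib, hcoset (s σ) (s τ) (σ * τ) (by simp [hs]),
    hcoset (s σ) 1 σ (by simp [hs]), mul_div_mul_left_eq_div]
  simp only [smul_inv', Finset.prod_inv_distrib, inv_inv, Finset.smul_prod']
  rw [div_eq_mul_inv]
  ac_rfl
end

section
/- Let G be a finite group acting transitively on the left on a set X, let x₀ ∈ X have stabilizer H, let A be an H-module, and let R ⊆ G be a set of representatives of the left cosets G/H with 1 ∈ R. For c ∈ Z²(H, A), define ES²_R(c) : G × G → ind_H^G(A) as follows: for σ, τ ∈ G, the element ES²_R(c)(σ,τ) of ind_H^G(A) takes, at each point h₃ r₁⁻¹ of G (h₃ ∈ H, r₁ ∈ R), the value h₃(c(h₁, h₂)), where r₂ ∈ R and h₁ ∈ H are the unique elements with σ = r₁ h₁ r₂⁻¹, and r₃ ∈ R and h₂ ∈ H are the unique elements with τ = r₂ h₂ r₃⁻¹. Then ES²_R(c) is a 2-cocycle in Z²(G, ind_H^G(A)). Moreover, if A is a G-module and φ : ind_H^G(A) → Maps(X,A) denotes the G-module isomorphism φ(f)(g·x₀) = g·f(g⁻¹), then φ(ES²_R(c)(r₁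 h₁ r₂⁻¹, r₂ h₂ r₃⁻¹))(r₁·x₀) = r₁(c(h₁, h₂)) for all r₁, r₂, r₃ ∈ R and h₁, h₂ ∈ H. -/
section CosetFactorization

variable {G : Type*} [Group G] {H : Subgroup G} {u : G ⧸ H → G}

/-- Every `g : G` is of the form `h r⁻¹` with `h ∈ H` and `r` a chosen representative. -/
theorem exists_eq_mul_inv_section (hu : ∀ q : G ⧸ H, ((u q : G) : G ⧸ H) = q) (g : G) :
    ∃ (h : H) (q : G ⧸ H), g = (h : G) * (u q)⁻¹ := by
  have hmem : g * u (g⁻¹ : G) ∈ H := by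
    simpa using QuotientGroup.eq.mp (hu (g⁻¹ : G)).symm
  exact ⟨⟨_, hmem⟩, (g⁻¹ : G), by simp⟩

theorem eq_and_eq_of_mul_inv_section_eq (hu : ∀ q : G ⧸ H, ((u q : G) : G ⧸ H) = q)
    {h k : H} {q p : G ⧸ H} (e : (h : G) * (u q)⁻¹ = (k : G) * (u p)⁻¹) : h = k ∧ q = p := by
  have hqp : q = p := by
    rw [← hu q, ← hu p, QuotientGroup.eq]
    have : (u q)⁻¹ * u p = ((h⁻¹ * k : H) : G) := by
      push_cast
      rw [eq_inv_mul_iff_mul_eq, ← mul_assoc, e, inv_mul_cancel_right]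
    exact this ▸ (h⁻¹ * k).2
  subst hqp
  exact ⟨Subtype.ext (mul_right_cancel e), rfl⟩

/-- Every `g : G` is of the form `r h r'⁻¹` with `r` a prescribed representative, `h ∈ H` and
`r'` a chosen representative. -/
theorem exists_eq_section_mul_mul_inv_section (hu : ∀ q : G ⧸ H, ((u q : G) : G ⧸ H) = q)
    (q : G ⧸ H) (g : G) :
    ∃ (h : H) (q' : G ⧸ H), g = u q * (h : G) * (u q')⁻¹ := by
  obtain ⟨h, q', e⟩ := exists_eq_mul_inv_section hu ((u q)⁻¹ * g)
  exact ⟨h, q', by rw [mul_assoc, ← e, mul_inv_cancel_left]⟩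

theorem eq_and_eq_of_section_mul_mul_inv_section_eq
    (hu : ∀ q : G ⧸ H, ((u q : G) : G ⧸ H) = q) {h k : H} {q q' p : G ⧸ H}
    (e : u q * (h : G) * (u q')⁻¹ = u q * (k : G) * (u p)⁻¹) : h = k ∧ q' = p :=
  eq_and_eq_of_mul_inv_section_eq hu (mul_left_cancel (by simpa only [mul_assoc] using e))

/-- The formula for the Eckmann–Shapiro lift of a 2-cochain is well defined. -/
theorem exists_eckmannShapiro_lift {A : Type*} [SMul H A]
    (hu : ∀ q : G ⧸ H, ((u q : G) : G ⧸ H) = q) (c : H → H → A) :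
    ∃ E : G → G → G → A, ∀ (q₁ q₂ q₃ : G ⧸ H) (h₁ h₂ h₃ : H),
      E (u q₁ * (h₁ : G) * (u q₂)⁻¹) (u q₂ * (h₂ : G) * (u q₃)⁻¹) ((h₃ : G) * (u q₁)⁻¹)
        = h₃ • c h₁ h₂ := by
  choose a p hap using exists_eq_mul_inv_section hu
  choose b r hbr using exists_eq_section_mul_mul_inv_section hu
  refine ⟨fun σ τ g => a g • c (b (p g) σ) (b (r (p g) σ) τ), fun q₁ q₂ q₃ h₁ h₂ h₃ => ?_⟩
  obtain ⟨e₁, e₂⟩ := eq_and_eq_of_mul_inv_section_eq hu (hap ((h₃ : G) * (u q₁)⁻¹))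
  obtain ⟨e₃, e₄⟩ := eq_and_eq_of_section_mul_mul_inv_section_eq hu
    (hbr q₁ (u q₁ * (h₁ : G) * (u q₂)⁻¹))
  obtain ⟨e₅, -⟩ := eq_and_eq_of_section_mul_mul_inv_section_eq hu
    (hbr q₂ (u q₂ * (h₂ : G) * (u q₃)⁻¹))
  simp only [← e₁, ← e₂, ← e₃, ← e₄, ← e₅]

end CosetFactorization


/-- Explicit Eckmann–Shapiro in degree 2. With `H` the stabilizer of
`x₀` in a transitive `G`-set `X` and `R = u(G/H)` a set of coset representatives
(`u` a section of `G → G/H` with `u 1 = 1`), for a 2-cocycle `c ∈ Z²(H,A)` the map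
`ES²_R(c)`, characterized by
`ES²_R(c)(r₁h₁r₂⁻¹, r₂h₂r₃⁻¹)(h₃r₁⁻¹) = h₃ • c(h₁,h₂)`,
exists and is a 2-cocycle in `Z²(G, ind_H^G(A))`. Moreover if the coefficients
form a `G`-module `B`, then under the `G`-module isomorphism
`φ(f)(g·x₀) = g • f(g⁻¹)` one has
`φ(ES²_R(c)(r₁h₁r₂⁻¹, r₂h₂r₃⁻¹))(r₁·x₀) = r₁ • c(h₁,h₂)`. -/
theorem eckmann_shapiro_degree_two {G X A B : Type*} [Group G] [Fintype G]
    [MulAction G X] [MulAction.IsPretransitive G X] (x₀ : X)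
    (H : Subgroup G) (hH : H = MulAction.stabilizer G x₀)
    [CommGroup A] [MulDistribMulAction H A]
    [CommGroup B] [MulDistribMulAction G B]
    (u : G ⧸ H → G) (hu : ∀ q : G ⧸ H, ((u q : G) : G ⧸ H) = q)
    (hu1 : u ((1 : G) : G ⧸ H) = 1)
    (c : H → H → A)
    (hc : ∀ h₁ h₂ h₃ : H, h₁ • c h₂ h₃ * c h₁ (h₂ * h₃) = c (h₁ * h₂) h₃ * c h₁ h₂)
    (cB : H → H → B)
    (hcB : ∀ h₁ h₂ h₃ : H,
      (h₁ : G) • cB h₂ h₃ * cB h₁ (h₂ * h₃) = cB (h₁ * h₂) h₃ * cB h₁ h₂) :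
    -- `ES²_R(c)` exists (well-definedness of the formula)
    (∃ E : G → G → G → A, ∀ (q₁ q₂ q₃ : G ⧸ H) (h₁ h₂ h₃ : H),
        E (u q₁ * (h₁ : G) * (u q₂)⁻¹) (u q₂ * (h₂ : G) * (u q₃)⁻¹)
            ((h₃ : G) * (u q₁)⁻¹)
          = h₃ • c h₁ h₂) ∧
    -- any map satisfying the formula takes values in `ind_H^G(A)` and is a
    -- 2-cocycle for the `G`-action `(g₁ · f)(g₂) = f (g₂ g₁)` on `ind_H^G(A)`
    (∀ E : G → G → G → A,
        (∀ (q₁ q₂ q₃ : G ⧸ H) (h₁ h₂ h₃ : H),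
            E (u q₁ * (h₁ : G) * (u q₂)⁻¹) (u q₂ * (h₂ : G) * (u q₃)⁻¹)
                ((h₃ : G) * (u q₁)⁻¹)
              = h₃ • c h₁ h₂) →
        (∀ (σ τ : G) (h : H) (g : G), E σ τ ((h : G) * g) = h • E σ τ g) ∧
        (∀ σ τ υ g : G,
          E τ υ (g * σ) * E σ (τ * υ) g = E (σ * τ) υ g * E σ τ g)) ∧
    -- the `G`-module case: existence, and the formula for `φ ∘ ES²_R(cB)`
    (∃ E : G → G → G → B, ∀ (q₁ q₂ q₃ : G ⧸ H) (h₁ h₂ h₃ : H),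
        E (u q₁ * (h₁ : G) * (u q₂)⁻¹) (u q₂ * (h₂ : G) * (u q₃)⁻¹)
            ((h₃ : G) * (u q₁)⁻¹)
          = (h₃ : G) • cB h₁ h₂) ∧
    (∀ E : G → G → G → B,
        (∀ (q₁ q₂ q₃ : G ⧸ H) (h₁ h₂ h₃ : H),
            E (u q₁ * (h₁ : G) * (u q₂)⁻¹) (u q₂ * (h₂ : G) * (u q₃)⁻¹)
                ((h₃ : G) * (u q₁)⁻¹)
              = (h₃ : G) • cB h₁ h₂) →
        ∀ (q₁ q₂ q₃ : G ⧸ H) (h₁ h₂ : H) (F : X → B),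
          (∀ g : G,
            F (g • x₀)
              = g • E (u q₁ * (h₁ : G) * (u q₂)⁻¹) (u q₂ * (h₂ : G) * (u q₃)⁻¹) g⁻¹) →
          F (u q₁ • x₀) = u q₁ • cB h₁ h₂) := by
  refine ⟨exists_eckmannShapiro_lift hu c, fun E hE => ⟨fun σ τ h g => ?_, fun σ τ υ g => ?_⟩,
    exists_eckmannShapiro_lift hu cB, fun E hE q₁ q₂ q₃ h₁ h₂ F hF => ?_⟩
  · obtain ⟨h₃, q₁, rfl⟩ := exists_eq_mul_inv_section hu g
    obtain ⟨h₁, q₂, rfl⟩ := exists_eq_section_mul_mul_inv_section hu q₁ σ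
    obtain ⟨h₂, q₃, rfl⟩ := exists_eq_section_mul_mul_inv_section hu q₂ τ
    rw [hE, ← mul_assoc, ← Subgroup.coe_mul, hE, mul_smul]
  · obtain ⟨h, q₁, rfl⟩ := exists_eq_mul_inv_section hu g
    obtain ⟨h₁, q₂, rfl⟩ := exists_eq_section_mul_mul_inv_section hu q₁ σ
    obtain ⟨h₂, q₃, rfl⟩ := exists_eq_section_mul_mul_inv_section hu q₂ τ
    obtain ⟨h₃, q₄, rfl⟩ := exists_eq_section_mul_mul_inv_section hu q₃ υ
    have hgσ : (h : G) * (u q₁)⁻¹ * (u q₁ * (h₁ : G) * (u q₂)⁻¹)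
        = ((h * h₁ : H) : G) * (u q₂)⁻¹ := by
      push_cast; group
    have hστ : u q₁ * (h₁ : G) * (u q₂)⁻¹ * (u q₂ * (h₂ : G) * (u q₃)⁻¹)
        = u q₁ * ((h₁ * h₂ : H) : G) * (u q₃)⁻¹ := by
      push_cast; group
    have hτυ : u q₂ * (h₂ : G) * (u q₃)⁻¹ * (u q₃ * (h₃ : G) * (u q₄)⁻¹)
        = u q₂ * ((h₂ * h₃ : H) : G) * (u q₄)⁻¹ := by
      push_cast; group
    rw [hgσ, hστ, hτυ, hE, hE, hE, hE, mul_smul, ← smul_mul', ← smul_mul', hc]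
  · rw [hF]
    simpa using congrArg (u q₁ • ·) (hE q₁ q₂ q₃ h₁ h₂ 1)
end

section
/- Let G be a finite group acting transitively on the left on a set X, let x₀ ∈ X have stabilizer H, let A be an H-module, and let R ⊆ G be a set of representatives of the left cosets G/H with 1 ∈ R. For a map c : H → A, define ES¹_R(c) : G → ind_H^G(A) by letting ES¹_R(c)(σ), for σ ∈ G, take at each point h₂ r₁⁻¹ of G (h₂ ∈ H, r₁ ∈ R) the value h₂(c(h₁)), where r₂ ∈ R and h₁ ∈ H are the unique elements with σ = r₁ h₁ r₂⁻¹. Then d(ES¹_R(c)) = ES²_R(d(c)), where d(c)(h₁,h₂) = c(h₁)·h₁(c(h₂))·c(h₁h₂)⁻¹ and d(ES¹_R(c))(σ,τ) = ES¹_R(c)(σ) · σ·(ES¹_R(c)(τ)) · ES¹_R(c)(στ)⁻¹ in ind_H^G(A). -/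
/-- Given a section `u` of `G → G ⧸ H`, every `g : G` factors uniquely as `h * (u q)⁻¹`. -/
theorem Subgroup.exists_mul_inv_section_factorization {G : Type*} [Group G] (H : Subgroup G)
    (u : G ⧸ H → G) (hu : ∀ q : G ⧸ H, ((u q : G) : G ⧸ H) = q) :
    ∃ (η : G → H) (π : G → G ⧸ H), (∀ g, (η g : G) * (u (π g))⁻¹ = g) ∧
      (∀ (h : H) (q : G ⧸ H), η ((h : G) * (u q)⁻¹) = h) ∧
      ∀ (h : H) (q : G ⧸ H), π ((h : G) * (u q)⁻¹) = q := by
  have hmem (g : G) : g * u ((g⁻¹ : G) : G ⧸ H) ∈ H := by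
    simpa using QuotientGroup.eq.1 (hu ((g⁻¹ : G) : G ⧸ H)).symm
  have hπ (h : H) (q : G ⧸ H) : ((((h : G) * (u q)⁻¹)⁻¹ : G) : G ⧸ H) = q := by
    rw [mul_inv_rev, inv_inv, QuotientGroup.mk_mul_of_mem _ (H.inv_mem h.2), hu]
  refine ⟨fun g => ⟨_, hmem g⟩, fun g => ((g⁻¹ : G) : G ⧸ H), fun g => by simp,
    fun h q => Subtype.ext ?_, hπ⟩
  simp only [hπ, inv_mul_cancel_right]

/-- Explicit Eckmann–Shapiro in degree 1 commutes with coboundaries.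
With `H` the stabilizer of `x₀` in a transitive `G`-set `X`, `u` a section of
`G → G/H` with `u 1 = 1` (`R = u(G/H)` the set of representatives),
`ES¹_R(c)` is characterized by `ES¹_R(c)(r₁h₁r₂⁻¹)(h₂r₁⁻¹) = h₂ • c(h₁)`, and
`ES²_R(c')` by `ES²_R(c')(r₁h₁r₂⁻¹, r₂h₂r₃⁻¹)(h₃r₁⁻¹) = h₃ • c'(h₁,h₂)`.
Then `d(ES¹_R(c)) = ES²_R(d(c))` for every 1-cochain `c : H → A`, where
`d(c)(h₁,h₂) = c(h₁) · h₁•c(h₂) · c(h₁h₂)⁻¹` and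
`d(ES¹_R(c))(σ,τ)(g) = ES¹_R(c)(σ)(g) · ES¹_R(c)(τ)(gσ) · ES¹_R(c)(στ)(g)⁻¹`. -/
theorem eckmann_shapiro_degree_one_commutes {G X A : Type*} [Group G] [Fintype G]
    [MulAction G X] [MulAction.IsPretransitive G X] (x₀ : X)
    (H : Subgroup G) (hH : H = MulAction.stabilizer G x₀)
    [CommGroup A] [MulDistribMulAction H A]
    (u : G ⧸ H → G) (hu : ∀ q : G ⧸ H, ((u q : G) : G ⧸ H) = q)
    (hu1 : u ((1 : G) : G ⧸ H) = 1)
    (c : H → A) :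
    -- `ES¹_R(c)` exists
    (∃ E1 : G → G → A, ∀ (q₁ q₂ : G ⧸ H) (h₁ h₂ : H),
        E1 (u q₁ * (h₁ : G) * (u q₂)⁻¹) ((h₂ : G) * (u q₁)⁻¹) = h₂ • c h₁) ∧
    -- `ES²_R(d c)` exists
    (∃ E2 : G → G → G → A, ∀ (q₁ q₂ q₃ : G ⧸ H) (h₁ h₂ h₃ : H),
        E2 (u q₁ * (h₁ : G) * (u q₂)⁻¹) (u q₂ * (h₂ : G) * (u q₃)⁻¹)
            ((h₃ : G) * (u q₁)⁻¹)
          = h₃ • (c h₁ * h₁ • c h₂ * (c (h₁ * h₂))⁻¹)) ∧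
    -- and `d(ES¹_R(c)) = ES²_R(d(c))`
    (∀ (E1 : G → G → A) (E2 : G → G → G → A),
        (∀ (q₁ q₂ : G ⧸ H) (h₁ h₂ : H),
            E1 (u q₁ * (h₁ : G) * (u q₂)⁻¹) ((h₂ : G) * (u q₁)⁻¹) = h₂ • c h₁) →
        (∀ (q₁ q₂ q₃ : G ⧸ H) (h₁ h₂ h₃ : H),
            E2 (u q₁ * (h₁ : G) * (u q₂)⁻¹) (u q₂ * (h₂ : G) * (u q₃)⁻¹)
                ((h₃ : G) * (u q₁)⁻¹)
              = h₃ • (c h₁ * h₁ • c h₂ * (c (h₁ * h₂))⁻¹)) →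
        ∀ σ τ g : G, E1 σ g * E1 τ (g * σ) * (E1 (σ * τ) g)⁻¹ = E2 σ τ g) := by
  obtain ⟨η, π, hfac, hη, hπ⟩ := H.exists_mul_inv_section_factorization u hu
  have hcancel (q₁ q₂ : G ⧸ H) (h : H) :
      (u q₁)⁻¹ * (u q₁ * (h : G) * (u q₂)⁻¹) = (h : G) * (u q₂)⁻¹ := by group
  refine ⟨⟨fun σ g => η g • c (η ((u (π g))⁻¹ * σ)), fun q₁ q₂ h₁ h₂ => ?_⟩,
    ⟨fun σ τ g => η g • (c (η ((u (π g))⁻¹ * σ)) *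
      η ((u (π g))⁻¹ * σ) • c (η ((u (π ((u (π g))⁻¹ * σ)))⁻¹ * τ)) *
      (c (η ((u (π g))⁻¹ * σ) * η ((u (π ((u (π g))⁻¹ * σ)))⁻¹ * τ)))⁻¹),
      fun q₁ q₂ q₃ h₁ h₂ h₃ => ?_⟩, fun E1 E2 hE1 hE2 σ τ g => ?_⟩
  · simp only [hπ, hη, hcancel]
  · simp only [hπ, hη, hcancel]
  · obtain ⟨h₃, q₁, rfl⟩ : ∃ (h : H) (q : G ⧸ H), g = (h : G) * (u q)⁻¹ :=
      ⟨_, _, (hfac g).symm⟩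
    obtain ⟨h₁, q₂, rfl⟩ : ∃ (h : H) (q : G ⧸ H), σ = u q₁ * (h : G) * (u q)⁻¹ :=
      ⟨η ((u q₁)⁻¹ * σ), π ((u q₁)⁻¹ * σ), by rw [mul_assoc, hfac, mul_inv_cancel_left]⟩
    obtain ⟨h₂, q₃, rfl⟩ : ∃ (h : H) (q : G ⧸ H), τ = u q₂ * (h : G) * (u q)⁻¹ :=
      ⟨η ((u q₂)⁻¹ * τ), π ((u q₂)⁻¹ * τ), by rw [mul_assoc, hfac, mul_inv_cancel_left]⟩
    have hgσ : (h₃ : G) * (u q₁)⁻¹ * (u q₁ * (h₁ : G) * (u q₂)⁻¹) =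
        ((h₃ * h₁ : H) : G) * (u q₂)⁻¹ := by
      rw [Subgroup.coe_mul]; group
    have hστ : u q₁ * (h₁ : G) * (u q₂)⁻¹ * (u q₂ * (h₂ : G) * (u q₃)⁻¹) =
        u q₁ * ((h₁ * h₂ : H) : G) * (u q₃)⁻¹ := by
      rw [Subgroup.coe_mul]; group
    rw [hgσ, hστ, hE1, hE1, hE1, hE2, smul_mul', smul_mul', smul_inv', mul_smul]
end

section
/- Let G be a finite group, N a normal subgroup of G, X a left G-set, Y the set of N-orbits on X with its induced G/N-action, p : X → Y the orbit map, and ζ : Y → X a section of p. Let Γ be a group with a surjective homomorphism onto G, and let A be a Γ-module. Then for every map β : G → Maps(X, A), one has AWES²(d(β)) = d(AWES¹(β)) as maps Γ × G/N → Maps(Y, A). Here d(β) : Γ × G → Maps(X,A) is given by d(β)(σ,τ)(x) = β(σ_G)(x) · σ(β(τ)(σ_G⁻¹·x)) · β(σ_G τ)(x)⁻¹, and d(AWES¹(β)) : Γ × G/N → Maps(Y,A) is given by d(AWES¹(β))(σ,τ)(y) = AWES¹(β)(σ_N)(y) · σ(AWES¹(β)(τ)(σ_N⁻¹·y)) ·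 AWES¹(β)(σ_N τ)(y)⁻¹, where σ_G and σ_N denote the images of σ ∈ Γ in G and in G/N. -/
/-- The map `AWES¹`: for `β : G → Maps(X,A)`,
`AWES¹(β)(σ)(σ·w) = ∏_{n∈N} β(n σ̃)(n σ̃ · ζ(w)) / β(n)(n · ζ(σ·w))`,
written at an arbitrary point `y = σ·w` of `Y`, with lift `σ̃ = L σ`. -/
def AWES1 {G X Y A : Type*} [Group G] [MulAction G X] [CommGroup A]
    (N : Subgroup G) [N.Normal] [Fintype N] [MulAction (G ⧸ N) Y]
    (ζ : Y → X) (L : G ⧸ N → G)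
    (β : G → X → A) (σ : G ⧸ N) (y : Y) : A :=
  ∏ n : N,
    β ((n : G) * L σ) (((n : G) * L σ) • ζ (σ⁻¹ • y)) /
      β (n : G) ((n : G) • ζ y)

/-- The map `AWES²`: for a group `Γ` with a homomorphism `π` onto `G` and
`α : Γ × G → Maps(X,A)`,
`AWES²(α)(σ,τ)(σ_N τ · w) = ∏_{n∈N} α(σ, n τ̃)(σ_G n τ̃ · ζ(w)) / α(σ, n)(σ_G n · ζ(τ·w))`,
written at an arbitrary point `y = σ_N τ · w` of `Y`, with lift `τ̃ = L τ`. -/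
def AWES2 {Γ G X Y A : Type*} [Group Γ] [Group G] [MulAction G X] [CommGroup A]
    (N : Subgroup G) [N.Normal] [Fintype N] [MulAction (G ⧸ N) Y]
    (ζ : Y → X) (L : G ⧸ N → G) (π : Γ →* G)
    (α : Γ → G → X → A) (σ : Γ) (τ : G ⧸ N) (y : Y) : A :=
  ∏ n : N,
    α σ ((n : G) * L τ)
        ((π σ * ((n : G) * L τ)) • ζ ((((π σ : G ⧸ N)) * τ)⁻¹ • y)) /
      α σ (n : G) ((π σ * (n : G)) • ζ (((π σ : G ⧸ N))⁻¹ • y))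

/-- A product over the coset `s N t = N u` does not depend on its presentation. -/
theorem Subgroup.prod_mul_coe_mul_eq_of_mk_eq {G A : Type*} [Group G] [CommMonoid A]
    (N : Subgroup G) [N.Normal] [Fintype N] (f : G → A) {s t u : G}
    (h : ((s * t : G) : G ⧸ N) = (u : G ⧸ N)) :
    ∏ n : N, f (s * (n : G) * t) = ∏ n : N, f ((n : G) * u) := by
  have hm : s * t * u⁻¹ ∈ N := by
    rw [← QuotientGroup.eq_one_iff, QuotientGroup.mk_mul, h, ← QuotientGroup.mk_mul,
      mul_inv_cancel, QuotientGroup.mk_one]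
  refine Fintype.prod_equiv
    ((MulAut.conjNormal s : MulAut N).toEquiv.trans (Equiv.mulRight ⟨s * t * u⁻¹, hm⟩)) _ _
    fun n => ?_
  simp [mul_assoc]

/-- A product over an orbit of a finite group does not depend on the base point. -/
theorem Subgroup.prod_coe_smul_eq {G X A : Type*} [Group G] [MulAction G X] [CommMonoid A]
    (N : Subgroup G) [Fintype N] (f : X → A) {x x' : X}
    (h : ∃ n : N, (n : G) • x = x') :
    ∏ n : N, f ((n : G) • x') = ∏ n : N, f ((n : G) • x) := by
  obtain ⟨m, rfl⟩ := h
  exact Fintype.prod_equiv (Equiv.mulRight m) _ _ fun n => by simp [mul_smul]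

/-- `AWES²(d(β)) = d(AWES¹(β))` for every `β : G → Maps(X,A)`,
where `Y` is the set of `N`-orbits of the `G`-set `X` (encoded by an equivariant
surjection `p` whose fibers are the `N`-orbits, with section `ζ`), `Γ` surjects
onto `G` via `π`, and `A` is a `Γ`-module. -/
theorem AWES2_coboundary_eq_coboundary_AWES1 {Γ G X Y A : Type*}
    [Group Γ] [Group G] [Fintype G]
    (N : Subgroup G) [N.Normal] [Fintype N]
    [MulAction G X] [MulAction (G ⧸ N) Y]
    (p : X → Y) (hp : ∀ (g : G) (x : X), p (g • x) = ((g : G ⧸ N)) • p x)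
    (hfib : ∀ x x' : X, p x = p x' ↔ ∃ n : N, (n : G) • x = x')
    (ζ : Y → X) (hζ : ∀ y : Y, p (ζ y) = y)
    (L : G ⧸ N → G) (hL : ∀ q : G ⧸ N, ((L q : G) : G ⧸ N) = q)
    [CommGroup A] [MulDistribMulAction Γ A]
    (π : Γ →* G) (hπ : Function.Surjective π)
    (β : G → X → A) :
    ∀ (σ : Γ) (τ : G ⧸ N) (y : Y),
      AWES2 N ζ L π
          (fun σ' τ' x => β (π σ') x * σ' • β τ' ((π σ')⁻¹ • x) * (β (π σ' * τ') x)⁻¹)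
          σ τ y
        = AWES1 N ζ L β ((π σ : G ⧸ N)) y
            * σ • AWES1 N ζ L β τ (((π σ : G ⧸ N))⁻¹ • y)
            * (AWES1 N ζ L β (((π σ : G ⧸ N)) * τ) y)⁻¹ := by
  intro σ τ y
  have hw : ((π σ : G ⧸ N) * τ)⁻¹ • y = τ⁻¹ • (π σ : G ⧸ N)⁻¹ • y := by
    rw [mul_inv_rev, mul_smul]
  simp only [AWES1, AWES2, hw]
  set v := (π σ : G ⧸ N)⁻¹ • y
  have h₁ : ∏ n : N, β (π σ) ((π σ * ((n : G) * L τ)) • ζ (τ⁻¹ • v)) =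
      ∏ n : N, β (π σ) ((π σ * (n : G)) • ζ v) := by
    simp only [mul_smul]
    refine N.prod_coe_smul_eq (fun x => β (π σ) (π σ • x)) ((hfib _ _).1 ?_)
    rw [hp, hζ, hζ, hL, smul_inv_smul]
  have h₂ : ∏ n : N, β (π σ * (n : G)) ((π σ * (n : G)) • ζ v) =
      ∏ n : N, β ((n : G) * L (π σ)) (((n : G) * L (π σ)) • ζ v) := by
    simpa only [mul_one] using N.prod_mul_coe_mul_eq_of_mk_eq (fun g => β g (g • ζ v))
      (s := π σ) (t := 1) (u := L (π σ)) (by rw [mul_one, hL])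
  have h₃ : ∏ n : N, β (π σ * ((n : G) * L τ)) ((π σ * ((n : G) * L τ)) • ζ (τ⁻¹ • v)) =
      ∏ n : N, β ((n : G) * L (π σ * τ)) (((n : G) * L (π σ * τ)) • ζ (τ⁻¹ • v)) := by
    simpa only [mul_assoc] using N.prod_mul_coe_mul_eq_of_mk_eq
      (fun g => β g (g • ζ (τ⁻¹ • v))) (s := π σ) (t := L τ) (u := L (π σ * τ))
      (by rw [QuotientGroup.mk_mul, hL, hL])
  have hs (g : G) (x : X) : (π σ)⁻¹ • (π σ * g) • x = g • x := by
    rw [mul_smul, inv_smul_smul]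
  simp only [hs, Finset.prod_div_distrib, Finset.prod_mul_distrib, Finset.prod_inv_distrib,
    smul_div', Finset.smul_prod', h₁, h₂, h₃]
  rw [mul_assoc, mul_assoc, mul_div_mul_left_eq_div, inv_div, mul_right_comm, div_mul_div_cancel]
  simp only [div_eq_mul_inv, mul_inv, inv_inv]
  ac_rfl
end

section
/- Let G be a finite group, N a normal subgroup of G, X a left G-set, Y the set of N-orbits on X with its induced G/N-action, p : X → Y the orbit map, ζ : Y → X a section of p, and A a G-module. Then for every β ∈ Maps(X, A), one has AWES¹(d(β)) = d(AWES⁰(β)) as maps G/N → Maps(Y, A), where d(β) : G → Maps(X,A) is given by d(β)(σ)(x) = σ(β(σ⁻¹·x)) · β(x)⁻¹, and d(AWES⁰(β)) : G/N → Maps(Y,A) is given by d(AWES⁰(β))(σ)(y) = σ̃(AWES⁰(β)(σ⁻¹·y)) · AWES⁰(β)(y)⁻¹ for any lift σ̃ ∈ G of σ (well defined since AWES⁰(β) takes values in A^N). Moreover d(AWES⁰(β)) takes values in Maps(Y, N_N(A)) where N_N(A) = { ∏_{n∈N} n(a) : a ∈ A }. -/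
/-- The map `AWES⁰`: for `β ∈ Maps(X,A)`, `AWES⁰(β)(w) = ∏_{n∈N} n(β(ζ(w)))`. -/
def AWES0 {G X Y A : Type*} [Group G] [MulAction G X]
    [CommGroup A] [MulDistribMulAction G A]
    (N : Subgroup G) [Fintype N] (ζ : Y → X) (β : X → A) (y : Y) : A :=
  ∏ n : N, (n : G) • β (ζ y)

theorem smul_prod_smul_normal {G A : Type*} [Group G] [CommGroup A] [MulDistribMulAction G A]
    (N : Subgroup G) [N.Normal] [Fintype N] (g : G) (a : A) :
    g • ∏ n : N, (n : G) • a = ∏ n : N, (n : G) • g • a := by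
  rw [Finset.smul_prod']
  refine Fintype.prod_equiv (MulAut.conjNormal (H := N) g).toEquiv _ _ fun n => ?_
  simp [smul_smul]

theorem prod_apply_mul_eq_of_mk_eq {G M : Type*} [Group G] [CommMonoid M]
    (N : Subgroup G) [N.Normal] [Fintype N] (f : G → M) {s t : G}
    (h : (s : G ⧸ N) = t) :
    ∏ n : N, f ((n : G) * s) = ∏ n : N, f ((n : G) * t) := by
  have hm : s / t ∈ N := QuotientGroup.eq_iff_div_mem.mp h
  refine Fintype.prod_equiv (Equiv.mulRight (⟨s / t, hm⟩ : N)) _ _ fun n => ?_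
  simp [mul_assoc]

theorem prod_apply_smul_eq_of_smul_eq {G X M : Type*} [Group G] [MulAction G X] [CommMonoid M]
    (N : Subgroup G) [Fintype N] (f : X → M) {x x' : X}
    (h : ∃ n : N, (n : G) • x = x') :
    ∏ n : N, f ((n : G) • x) = ∏ n : N, f ((n : G) • x') := by
  obtain ⟨m, rfl⟩ := h
  exact Fintype.prod_equiv (Equiv.mulRight m⁻¹) _ _ fun n => by simp [smul_smul]

/-- `AWES¹(d(β)) = d(AWES⁰(β))` for every `β ∈ Maps(X,A)`, where
`Y` is the set of `N`-orbits of the `G`-set `X` (encoded by an equivariant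
surjection `p` whose fibers are the `N`-orbits, with section `ζ`), `A` is a
`G`-module, `d(β)(σ)(x) = σ(β(σ⁻¹·x))·β(x)⁻¹`, and
`d(AWES⁰(β))(σ)(y) = σ̃(AWES⁰(β)(σ⁻¹·y))·AWES⁰(β)(y)⁻¹` for any lift `σ̃` of `σ`;
moreover `d(AWES⁰(β))` takes values in `N_N(A) = {∏_{n∈N} n(a) | a ∈ A}`. -/
theorem AWES1_coboundary_eq_coboundary_AWES0 {G X Y A : Type*}
    [Group G] [Fintype G]
    (N : Subgroup G) [N.Normal] [Fintype N]
    [MulAction G X] [MulAction (G ⧸ N) Y]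
    (p : X → Y) (hp : ∀ (g : G) (x : X), p (g • x) = ((g : G ⧸ N)) • p x)
    (hfib : ∀ x x' : X, p x = p x' ↔ ∃ n : N, (n : G) • x = x')
    (ζ : Y → X) (hζ : ∀ y : Y, p (ζ y) = y)
    (L : G ⧸ N → G) (hL : ∀ q : G ⧸ N, ((L q : G) : G ⧸ N) = q)
    [CommGroup A] [MulDistribMulAction G A]
    (β : X → A) :
    ∀ (σ : G ⧸ N) (σt : G), ((σt : G ⧸ N)) = σ → ∀ y : Y,
      AWES1 N ζ L (fun g x => g • β (g⁻¹ • x) * (β x)⁻¹) σ y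
          = σt • AWES0 N ζ β (σ⁻¹ • y) * (AWES0 N ζ β y)⁻¹ ∧
      ∃ a : A,
        σt • AWES0 N ζ β (σ⁻¹ • y) * (AWES0 N ζ β y)⁻¹ = ∏ n : N, (n : G) • a := by
  rintro σ σt rfl y
  have hcoset : ((L σt : G) : G ⧸ N) = σt := hL σt
  have horbit : ∃ n : N, (n : G) • (L σt • ζ ((σt : G ⧸ N)⁻¹ • y)) = ζ y := by
    rw [← hfib, hp, hζ, hζ, hcoset, smul_inv_smul]
  constructor
  · have hprod := prod_apply_smul_eq_of_smul_eq N β horbit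
    have hlift := prod_apply_mul_eq_of_mk_eq N
      (fun g => g • β (ζ ((σt : G ⧸ N)⁻¹ • y))) hcoset
    simp only [AWES1, AWES0, inv_smul_smul, Finset.prod_div_distrib, Finset.prod_mul_distrib,
      Finset.prod_inv_distrib, smul_prod_smul_normal]
    simp only [mul_smul] at hlift ⊢
    rw [hprod, hlift, mul_div_mul_right_eq_div, div_eq_mul_inv]
  · refine ⟨σt • β (ζ ((σt : G ⧸ N)⁻¹ • y)) * (β (ζ y))⁻¹, ?_⟩
    simp only [AWES0, smul_prod_smul_normal, smul_mul', smul_inv', Finset.prod_mul_distrib,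
      Finset.prod_inv_distrib]
end

section
/- Let G be a finite group, N a normal subgroup of G, X a left G-set, Y the set of N-orbits on X with its induced G/N-action, p : X → Y the orbit map, ζ : Y → X a section of p, and A a G-module. If β : G → Maps(X, A) is a 1-cocycle, i.e. β(στ)(x) = β(σ)(x) · σ(β(τ)(σ⁻¹·x)) for all σ, τ ∈ G and x ∈ X, then AWES¹(β) is a 1-cocycle of G/N with values in Maps(Y, A^N): AWES¹(β)(σ)(y) ∈ A^N for all σ ∈ G/N, y ∈ Y, and AWES¹(β)(στ)(y) = AWES¹(β)(σ)(y) · σ̃(AWES¹(β)(τ)(σ⁻¹·y)) for all σ, τ ∈ G/N, y ∈ Y and any lift σ̃ ∈ G of σ. -/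
/-- The product over the coset `N g` of the values of `β`, transported to the base point `z`. -/
def cosetProd {G X A : Type*} [Group G] [MulAction G X] [CommGroup A]
    (N : Subgroup G) [Fintype N] (β : G → X → A) (g : G) (z : X) : A :=
  ∏ n : N, β ((n : G) * g) (((n : G) * g) • z)

theorem cosetProd_mul_left {G X A : Type*} [Group G] [MulAction G X] [CommGroup A]
    (N : Subgroup G) [Fintype N] (β : G → X → A) (m : N) (g : G) (z : X) :
    cosetProd N β ((m : G) * g) z = cosetProd N β g z := by
  unfold cosetProd
  refine Fintype.prod_equiv (Equiv.mulRight m) _ _ fun n => ?_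
  simp [mul_assoc]

theorem cosetProd_congr {G X A : Type*} [Group G] [MulAction G X] [CommGroup A]
    (N : Subgroup G) [N.Normal] [Fintype N] (β : G → X → A) {g h : G}
    (hgh : (g : G ⧸ N) = h) (z : X) :
    cosetProd N β g z = cosetProd N β h z := by
  have hm : g * h⁻¹ ∈ N := by
    rw [← QuotientGroup.eq_one_iff, QuotientGroup.mk_mul, QuotientGroup.mk_inv, hgh,
      mul_inv_cancel]
  simpa using cosetProd_mul_left N β ⟨g * h⁻¹, hm⟩ h z

theorem cosetProd_mul_of_cocycle {G X A : Type*} [Group G] [MulAction G X] [CommGroup A]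
    [MulDistribMulAction G A] (N : Subgroup G) [N.Normal] [Fintype N] (β : G → X → A)
    (hβ : ∀ (σ τ : G) (x : X), β (σ * τ) x = β σ x * σ • β τ (σ⁻¹ • x)) (s t : G) (z : X) :
    cosetProd N β (s * t) z
      = (∏ n : N, β s (s • (n : G) • t • z)) * s • cosetProd N β t z := by
  unfold cosetProd
  rw [Finset.smul_prod', ← Finset.prod_mul_distrib]
  symm
  refine Fintype.prod_equiv (MulAut.conjNormal s).toEquiv _ _ fun n => ?_
  have h : ((MulAut.conjNormal s n : N) : G) * (s * t) = s * ((n : G) * t) := by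
    simp [MulAut.conjNormal_apply, mul_assoc]
  change _ = β (((MulAut.conjNormal s n : N) : G) * (s * t))
    ((((MulAut.conjNormal s n : N) : G) * (s * t)) • z)
  rw [h, hβ s]
  simp [mul_smul]

theorem smul_cosetProd_div {G X A : Type*} [Group G] [MulAction G X] [CommGroup A]
    [MulDistribMulAction G A] (N : Subgroup G) [N.Normal] [Fintype N] (β : G → X → A)
    (hβ : ∀ (σ τ : G) (x : X), β (σ * τ) x = β σ x * σ • β τ (σ⁻¹ • x)) (s t : G) {z w : X}
    (hzw : ∃ k : N, (k : G) • w = t • z) :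
    s • (cosetProd N β t z / cosetProd N β 1 w)
      = cosetProd N β (s * t) z / cosetProd N β s w := by
  obtain ⟨k, hk⟩ := hzw
  have hprod : ∏ n : N, β s (s • (n : G) • t • z) = ∏ n : N, β s (s • (n : G) • w) := by
    refine Fintype.prod_equiv (Equiv.mulRight k) _ _ fun n => ?_
    simp [← hk, mul_smul]
  have hw := cosetProd_mul_of_cocycle N β hβ s 1 w
  rw [mul_one, one_smul] at hw
  rw [cosetProd_mul_of_cocycle N β hβ s t z, hw, hprod, smul_div', mul_div_mul_left_eq_div]

theorem AWES1_eq_cosetProd_div {G X Y A : Type*} [Group G] [MulAction G X] [CommGroup A]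
    (N : Subgroup G) [N.Normal] [Fintype N] [MulAction (G ⧸ N) Y]
    (ζ : Y → X) (L : G ⧸ N → G) (β : G → X → A) (σ : G ⧸ N) (y : Y) :
    AWES1 N ζ L β σ y = cosetProd N β (L σ) (ζ (σ⁻¹ • y)) / cosetProd N β 1 (ζ y) := by
  simp [AWES1, cosetProd, Finset.prod_div_distrib]

/-- If `β : G → Maps(X,A)` is a 1-cocycle, i.e.
`β(στ)(x) = β(σ)(x)·σ(β(τ)(σ⁻¹·x))`, then `AWES¹(β)` is a 1-cocycle of `G/N` with
values in `Maps(Y, A^N)`: its values are `N`-invariant, and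
`AWES¹(β)(στ)(y) = AWES¹(β)(σ)(y) · σ̃(AWES¹(β)(τ)(σ⁻¹·y))` for any lift `σ̃` of
`σ`. Here `Y` is the set of `N`-orbits of the `G`-set `X` (encoded by an
equivariant surjection `p` whose fibers are the `N`-orbits, with section `ζ`)
and `A` is a `G`-module. -/
theorem AWES1_of_cocycle_is_cocycle {G X Y A : Type*}
    [Group G] [Fintype G]
    (N : Subgroup G) [N.Normal] [Fintype N]
    [MulAction G X] [MulAction (G ⧸ N) Y]
    (p : X → Y) (hp : ∀ (g : G) (x : X), p (g • x) = ((g : G ⧸ N)) • p x)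
    (hfib : ∀ x x' : X, p x = p x' ↔ ∃ n : N, (n : G) • x = x')
    (ζ : Y → X) (hζ : ∀ y : Y, p (ζ y) = y)
    (L : G ⧸ N → G) (hL : ∀ q : G ⧸ N, ((L q : G) : G ⧸ N) = q)
    [CommGroup A] [MulDistribMulAction G A]
    (β : G → X → A)
    (hβ : ∀ (σ τ : G) (x : X), β (σ * τ) x = β σ x * σ • β τ (σ⁻¹ • x)) :
    (∀ (σ : G ⧸ N) (y : Y) (m : N),
        (m : G) • AWES1 N ζ L β σ y = AWES1 N ζ L β σ y) ∧
    (∀ (σ τ : G ⧸ N) (y : Y) (σt : G), ((σt : G ⧸ N)) = σ →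
        AWES1 N ζ L β (σ * τ) y
          = AWES1 N ζ L β σ y * σt • AWES1 N ζ L β τ (σ⁻¹ • y)) := by
  have key (s : G) (τ : G ⧸ N) (y : Y) : s • AWES1 N ζ L β τ y
      = cosetProd N β (s * L τ) (ζ (τ⁻¹ • y)) / cosetProd N β s (ζ y) := by
    rw [AWES1_eq_cosetProd_div]
    refine smul_cosetProd_div N β hβ s (L τ) ((hfib _ _).1 ?_)
    rw [hp, hL, hζ, hζ, smul_inv_smul]
  constructor
  · intro σ y m
    have hm := cosetProd_mul_left N β m 1 (ζ y)
    rw [mul_one] at hm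
    rw [key, cosetProd_mul_left, hm, AWES1_eq_cosetProd_div]
  · rintro _ τ y s rfl
    have hs : cosetProd N β (L s) (ζ ((s : G ⧸ N)⁻¹ • y))
        = cosetProd N β s (ζ ((s : G ⧸ N)⁻¹ • y)) := cosetProd_congr N β (hL _) _
    have hst : cosetProd N β (L (s * τ)) (ζ (τ⁻¹ • (s : G ⧸ N)⁻¹ • y))
        = cosetProd N β (s * L τ) (ζ (τ⁻¹ • (s : G ⧸ N)⁻¹ • y)) :=
      cosetProd_congr N β (by rw [hL, QuotientGroup.mk_mul, hL]) _
    rw [key, AWES1_eq_cosetProd_div, AWES1_eq_cosetProd_div, mul_inv_rev, mul_smul, hs, hst,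
      mul_comm, div_mul_div_cancel]
end

section
/- Let G be a finite group, N a normal subgroup of G, X a left G-set, Y the set of N-orbits on X with its induced G/N-action, p : X → Y the orbit map, ζ : Y → X a section of p, and A an abelian group (written multiplicatively). The map AWES¹, restricted to the set of maps β : G → Maps(X, A) with β(1) = 1 (the constant function 1 on X), is surjective onto the set of maps β' : G/N → Maps(Y, A) with β'(1) = 1. -/
/-- The map `AWES¹`, restricted to the maps `β : G → Maps(X,A)` with
`β(1) = 1`, is surjective onto the maps `β' : G/N → Maps(Y,A)` with `β'(1) = 1`.
Here `Y` is the set of `N`-orbits of the `G`-set `X` (encoded by an equivariant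
surjection `p` whose fibers are the `N`-orbits, with section `ζ`), and `A` is an
abelian group. -/
theorem AWES1_surjective {G X Y A : Type*}
    [Group G] [Fintype G]
    (N : Subgroup G) [N.Normal] [Fintype N]
    [MulAction G X] [MulAction (G ⧸ N) Y]
    (p : X → Y) (hp : ∀ (g : G) (x : X), p (g • x) = ((g : G ⧸ N)) • p x)
    (hfib : ∀ x x' : X, p x = p x' ↔ ∃ n : N, (n : G) • x = x')
    (ζ : Y → X) (hζ : ∀ y : Y, p (ζ y) = y)
    (L : G ⧸ N → G) (hL : ∀ q : G ⧸ N, ((L q : G) : G ⧸ N) = q)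
    [CommGroup A]
    (β' : G ⧸ N → Y → A) (hβ' : ∀ y : Y, β' 1 y = 1) :
    ∃ β : G → X → A, (∀ x : X, β 1 x = 1) ∧
      ∀ (σ : G ⧸ N) (y : Y), AWES1 N ζ L β σ y = β' σ y := by
  classical
  have hβN (n : N) (y : Y) : β' ((n : G) : G ⧸ N) y = 1 := by
    rw [(QuotientGroup.eq_one_iff (n : G)).2 n.2, hβ']
  refine ⟨fun g x => if g = L (g : G ⧸ N) then β' (g : G ⧸ N) (p x) else 1, fun x => ?_,
    fun σ y => ?_⟩
  · simp [hβ']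
  · have hclass (n : N) : (((n : G) * L σ : G) : G ⧸ N) = σ := by
      rw [QuotientGroup.mk_mul, (QuotientGroup.eq_one_iff (n : G)).2 n.2, one_mul, hL]
    have hpoint (n : N) : p (((n : G) * L σ) • ζ (σ⁻¹ • y)) = y := by
      rw [hp, hclass, hζ, smul_inv_smul]
    simp only [AWES1, hclass, hpoint, hβN, ite_self, div_one, mul_eq_right,
      OneMemClass.coe_eq_one, Finset.prod_ite_eq', Finset.mem_univ, if_true]
end

section
/- Let G be a finite group, N a normal subgroup of G, X a left G-set, Y the set of N-orbits on X with its induced G/N-action, p : X → Y the orbit map, ζ : Y → X a section of p, A an abelian group (written multiplicatively), and Γ a group equipped with a surjective homomorphism onto G. The map AWES², restricted to the set of maps α : Γ × G → Maps(X, A) with α(σ,1) = 1 for all σ ∈ Γ, is surjective onto the set of maps α' : Γ × G/N → Maps(Y, A) with α'(σ,1) = 1 for all σ ∈ Γ. -/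
/-- The map `AWES²`, restricted to the maps `α : Γ × G → Maps(X,A)`
with `α(σ,1) = 1` for all `σ ∈ Γ`, is surjective onto the maps
`α' : Γ × G/N → Maps(Y,A)` with `α'(σ,1) = 1` for all `σ ∈ Γ`. Here `Γ` is a
group with a surjective homomorphism `π` onto `G`, `Y` is the set of `N`-orbits
of the `G`-set `X` (encoded by an equivariant surjection `p` whose fibers are the
`N`-orbits, with section `ζ`), and `A` is an abelian group. -/
theorem AWES2_surjective {Γ G X Y A : Type*}
    [Group Γ] [Group G] [Fintype G]
    (N : Subgroup G) [N.Normal] [Fintype N]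
    [MulAction G X] [MulAction (G ⧸ N) Y]
    (p : X → Y) (hp : ∀ (g : G) (x : X), p (g • x) = ((g : G ⧸ N)) • p x)
    (hfib : ∀ x x' : X, p x = p x' ↔ ∃ n : N, (n : G) • x = x')
    (ζ : Y → X) (hζ : ∀ y : Y, p (ζ y) = y)
    (L : G ⧸ N → G) (hL : ∀ q : G ⧸ N, ((L q : G) : G ⧸ N) = q)
    [CommGroup A]
    (π : Γ →* G) (hπ : Function.Surjective π)
    (α' : Γ → G ⧸ N → Y → A) (hα' : ∀ (σ : Γ) (y : Y), α' σ 1 y = 1) :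
    ∃ α : Γ → G → X → A, (∀ (σ : Γ) (x : X), α σ 1 x = 1) ∧
      ∀ (σ : Γ) (τ : G ⧸ N) (y : Y), AWES2 N ζ L π α σ τ y = α' σ τ y := by
  classical
  refine ⟨fun σ g x => if g = L (g : G ⧸ N) then α' σ (g : G ⧸ N) (p x) else 1, ?_, ?_⟩
  · intro σ x
    simp [hα']
  · intro σ τ y
    have hN : ∀ n : N, ((n : G) : G ⧸ N) = 1 := fun n =>
      (QuotientGroup.eq_one_iff (n : G)).2 n.2
    unfold AWES2
    rw [Finset.prod_eq_single (1 : N)]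
    · simp [hα', hL, hp, hζ, smul_smul]
    · intro n _ hn
      have hnL : (((n : G) * L τ : G) : G ⧸ N) = τ := by
        rw [QuotientGroup.mk_mul, hN, hL, one_mul]
      have hn' : (n : G) ≠ 1 := fun h => hn (Subtype.ext h)
      simp only [hnL, hN, hα']
      simp [hn']
    · simp
end

section
/- Let E = ℚ(ζ) be the cyclotomic field generated by a primitive 12th root of unity ζ. Then the unit group of the ring of integers of E is generated by ζ and ζ − 1; moreover ζ − 1 is a unit of infinite order. -/
open NumberField

section IntegralRelations

variable {R : Type*} [CommRing R]

/-- The element of `ℤ[ζ]` with given coordinates in `1, ζ, ζ ^ 2, ζ ^ 3`. -/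
def cubicCombination (ζ : R) (a b c d : ℤ) : R := a + b * ζ + c * ζ ^ 2 + d * ζ ^ 3

/-- The rational part of the relative norm to `ℤ[√3]`. -/
def normRat (a b c d : ℤ) : ℤ := a ^ 2 + b ^ 2 + c ^ 2 + d ^ 2 + a * c + b * d

/-- The coefficient of `√3` in the relative norm to `ℤ[√3]`. -/
def normSqrt (a b c d : ℤ) : ℤ := a * b + b * c + c * d

theorem cubicCombination_mul {ζ : R} (h : ζ ^ 4 = ζ ^ 2 - 1) (a b c d a' b' c' d' : ℤ) :
    ∃ e f g k : ℤ,
      cubicCombination ζ a b c d * cubicCombination ζ a' b' c' d' = cubicCombination ζ e f g k ∧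
      normRat e f g k = normRat a b c d * normRat a' b' c' d' +
        3 * normSqrt a b c d * normSqrt a' b' c' d' ∧
      normSqrt e f g k = normRat a b c d * normSqrt a' b' c' d' +
        normSqrt a b c d * normRat a' b' c' d' := by
  refine ⟨a * a' - (b * d' + c * c' + d * b') - d * d', a * b' + b * a' - (c * d' + d * c'),
    a * c' + b * b' + c * a' + (b * d' + c * c' + d * b'),
    a * d' + b * c' + c * b' + d * a' + (c * d' + d * c'), ?_, ?_, ?_⟩
  · simp only [cubicCombination]
    push_cast
    linear_combination ((b * d' + c * c' + d * b' : R) + (c * d' + d * c') * ζ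
      + d * d' * (ζ ^ 2 + 1)) * h
  · simp only [normRat, normSqrt]; ring
  · simp only [normRat, normSqrt]; ring

theorem IsPrimitiveRoot.pow_four_eq_of_twelve [IsDomain R] {ζ : R} (hζ : IsPrimitiveRoot ζ 12) :
    ζ ^ 4 = ζ ^ 2 - 1 := by
  have h6 : ζ ^ 6 ≠ 1 := hζ.pow_ne_one_of_pos_of_lt (by norm_num) (by norm_num)
  have h4 : ζ ^ 4 ≠ 1 := hζ.pow_ne_one_of_pos_of_lt (by norm_num) (by norm_num)
  have h : (ζ ^ 6 - 1) * ((ζ ^ 2 + 1) * (ζ ^ 4 - ζ ^ 2 + 1)) = 0 := by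
    linear_combination hζ.pow_eq_one
  rcases mul_eq_zero.1 h with h | h
  · exact absurd (sub_eq_zero.1 h) h6
  rcases mul_eq_zero.1 h with h | h
  · exact absurd (by linear_combination (ζ ^ 2 - 1) * h) h4
  · linear_combination h

theorem exists_cubicCombination_of_mem_adjoin {ζ : R} (h : ζ ^ 4 = ζ ^ 2 - 1) {x : R}
    (hx : x ∈ Algebra.adjoin ℤ {ζ}) : ∃ a b c d : ℤ, x = cubicCombination ζ a b c d := by
  induction hx using Algebra.adjoin_induction with
  | mem x hx =>
    obtain rfl := Set.mem_singleton_iff.1 hx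
    exact ⟨0, 1, 0, 0, by simp [cubicCombination]⟩
  | algebraMap r => exact ⟨r, 0, 0, 0, by simp [cubicCombination]⟩
  | add x y _ _ hx hy =>
    obtain ⟨a, b, c, d, rfl⟩ := hx
    obtain ⟨a', b', c', d', rfl⟩ := hy
    exact ⟨a + a', b + b', c + c', d + d', by simp only [cubicCombination]; push_cast; ring⟩
  | mul x y _ _ hx hy =>
    obtain ⟨a, b, c, d, rfl⟩ := hx
    obtain ⟨a', b', c', d', rfl⟩ := hy
    obtain ⟨e, f, g, k, h, -⟩ := cubicCombination_mul h a b c d a' b' c' d'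
    exact ⟨e, f, g, k, h⟩

theorem IsPrimitiveRoot.cubicCombination_eq_zero [IsDomain R] [CharZero R] {ζ : R}
    (hζ : IsPrimitiveRoot ζ 12) {a b c d : ℤ} (h : cubicCombination ζ a b c d = 0) :
    a = 0 ∧ b = 0 ∧ c = 0 ∧ d = 0 := by
  set p : Polynomial ℤ := .C d * .X ^ 3 + .C c * .X ^ 2 + .C b * .X + .C a with hp
  have hroot : Polynomial.aeval ζ p = 0 := by
    simp only [cubicCombination] at h
    simp only [hp, map_add, map_mul, map_pow, map_intCast, Polynomial.aeval_X, eq_intCast]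
    linear_combination h
  have hdvd : minpoly ℤ ζ ∣ p :=
    minpoly.isIntegrallyClosed_dvd (hζ.isIntegral (by norm_num)) hroot
  have hp0 : p = 0 := by
    by_contra hne
    have h1 := Polynomial.natDegree_le_of_dvd hdvd hne
    have h2 := hζ.totient_le_degree_minpoly
    have h3 : p.natDegree ≤ 3 := by rw [hp]; compute_degree
    have h4 : Nat.totient 12 = 4 := by decide
    omega
  have hcubic : p = (⟨d, c, b, a⟩ : Cubic ℤ).toPoly := rfl
  rw [hcubic, Cubic.toPoly_eq_zero_iff, Cubic.mk.injEq] at hp0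
  obtain ⟨hd, hc, hb, ha⟩ := hp0
  exact ⟨ha, hb, hc, hd⟩

theorem IsPrimitiveRoot.cubicCombination_eq_one [IsDomain R] [CharZero R] {ζ : R}
    (hζ : IsPrimitiveRoot ζ 12) {a b c d : ℤ} (h : cubicCombination ζ a b c d = 1) :
    normRat a b c d = 1 ∧ normSqrt a b c d = 0 := by
  obtain ⟨ha, rfl, rfl, rfl⟩ := hζ.cubicCombination_eq_zero (a := a - 1) (b := b) (c := c) (d := d)
    (by simp only [cubicCombination] at h ⊢; push_cast; linear_combination h)
  obtain rfl : a = 1 := by omega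
  simp [normRat, normSqrt]

theorem normRat_nonneg (a b c d : ℤ) : 0 ≤ normRat a b c d := by
  simp only [normRat]
  nlinarith [sq_nonneg (a + c), sq_nonneg (b + d), sq_nonneg a, sq_nonneg b, sq_nonneg c,
    sq_nonneg d]

theorem exists_eq_pow_of_normRat_eq_one {ζ : R} (h : ζ ^ 4 = ζ ^ 2 - 1) {a b c d : ℤ}
    (hN : normRat a b c d = 1) : ∃ n : ℕ, cubicCombination ζ a b c d = ζ ^ n := by
  have h5 : ζ ^ 5 = ζ ^ 3 - ζ := by linear_combination ζ * h
  have h6 : ζ ^ 6 = -1 := by linear_combination (ζ ^ 2 + 1) * h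
  have h7 : ζ ^ 7 = -ζ := by linear_combination ζ * h6
  have h8 : ζ ^ 8 = -ζ ^ 2 := by linear_combination ζ ^ 2 * h6
  have h9 : ζ ^ 9 = -ζ ^ 3 := by linear_combination ζ ^ 3 * h6
  have h10 : ζ ^ 10 = 1 - ζ ^ 2 := by linear_combination ζ ^ 4 * h6 - h
  have h11 : ζ ^ 11 = ζ - ζ ^ 3 := by linear_combination ζ ^ 5 * h6 - h5
  simp only [normRat] at hN
  have bound {x : ℤ} (hx : 3 * x ^ 2 ≤ 4) : -1 ≤ x ∧ x ≤ 1 := by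
    constructor <;> nlinarith
  obtain ⟨ha, ha'⟩ := bound (x := a) (by
    nlinarith [sq_nonneg (a + 2 * c), sq_nonneg (b + d), sq_nonneg b, sq_nonneg d])
  obtain ⟨hb, hb'⟩ := bound (x := b) (by
    nlinarith [sq_nonneg (b + 2 * d), sq_nonneg (a + c), sq_nonneg a, sq_nonneg c])
  obtain ⟨hc, hc'⟩ := bound (x := c) (by
    nlinarith [sq_nonneg (c + 2 * a), sq_nonneg (b + d), sq_nonneg b, sq_nonneg d])
  obtain ⟨hd, hd'⟩ := bound (x := d) (by
    nlinarith [sq_nonneg (d + 2 * b), sq_nonneg (a + c), sq_nonneg a, sq_nonneg c])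
  have key : cubicCombination ζ a b c d = 1 ∨ cubicCombination ζ a b c d = ζ ∨
      cubicCombination ζ a b c d = ζ ^ 2 ∨ cubicCombination ζ a b c d = ζ ^ 3 ∨
      cubicCombination ζ a b c d = ζ ^ 2 - 1 ∨ cubicCombination ζ a b c d = ζ ^ 3 - ζ ∨
      cubicCombination ζ a b c d = -1 ∨ cubicCombination ζ a b c d = -ζ ∨
      cubicCombination ζ a b c d = -ζ ^ 2 ∨ cubicCombination ζ a b c d = -ζ ^ 3 ∨
      cubicCombination ζ a b c d = 1 - ζ ^ 2 ∨ cubicCombination ζ a b c d = ζ - ζ ^ 3 := by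
    simp only [cubicCombination]
    interval_cases a <;> interval_cases b <;> interval_cases c <;> interval_cases d <;>
      first
      | (revert hN; norm_num; done)
      | (push_cast; ring_nf; simp)
  simp only [← h, ← h5, ← h6, ← h7, ← h8, ← h9, ← h10, ← h11] at key
  rcases key with h | h | h | h | h | h | h | h | h | h | h | h
  · exact ⟨0, by simpa using h⟩
  · exact ⟨1, by simpa using h⟩
  all_goals exact ⟨_, h⟩

theorem IsPrimitiveRoot.norm_eq_one_of_unit [IsDomain R] [CharZero R] {ζ : R}
    (hζ : IsPrimitiveRoot ζ 12) {a b c d a' b' c' d' : ℤ}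
    (h : cubicCombination ζ a b c d * cubicCombination ζ a' b' c' d' = 1) :
    normRat a b c d ^ 2 - 3 * normSqrt a b c d ^ 2 = 1 := by
  obtain ⟨e, f, g, k, hmul, hP, hQ⟩ :=
    cubicCombination_mul hζ.pow_four_eq_of_twelve a b c d a' b' c' d'
  obtain ⟨h1, h0⟩ := hζ.cubicCombination_eq_one (hmul.symm.trans h)
  rw [h1] at hP
  rw [h0] at hQ
  generalize normRat a b c d = P at *
  generalize normSqrt a b c d = Q at *
  generalize normRat a' b' c' d' = P' at *
  generalize normSqrt a' b' c' d' = Q' at *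
  have hn : (P ^ 2 - 3 * Q ^ 2) * (P' ^ 2 - 3 * Q' ^ 2) = 1 := by
    linear_combination -(P * P' + 3 * Q * Q' + 1) * hP + 3 * (P * Q' + Q * P') * hQ
  rcases Int.eq_one_or_neg_one_of_mul_eq_one hn with h | h
  · exact h
  · exfalso
    have h3 : P ^ 2 % 3 = 2 := by omega
    rcases (by omega : P % 3 = 0 ∨ P % 3 = 1 ∨ P % 3 = 2) with h | h | h <;>
      simp [pow_two, Int.mul_emod, h] at h3

theorem IsPrimitiveRoot.unit_mem_closure_of_adjoin_eq_top [IsDomain R] [CharZero R] {u v : Rˣ}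
    (hu : IsPrimitiveRoot (u : R) 12) (hv : (v : R) = u - 1)
    (htop : Algebra.adjoin ℤ {(u : R)} = ⊤) (w : Rˣ) : w ∈ Subgroup.closure {u, v} := by
  have h4 := hu.pow_four_eq_of_twelve
  have hvH : v ∈ Subgroup.closure {u, v} := Subgroup.subset_closure (by simp)
  have huH : u ∈ Subgroup.closure {u, v} := Subgroup.subset_closure (by simp)
  have hv1 : (v : R) = cubicCombination (u : R) (-1) 1 0 0 := by
    rw [hv]; simp [cubicCombination]; ring
  have hv2 : ((v⁻¹ : Rˣ) : R) = cubicCombination (u : R) 0 0 (-1) (-1) := by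
    refine Units.inv_eq_of_mul_eq_one_right ?_
    rw [hv]
    simp only [cubicCombination]
    push_cast
    linear_combination -h4
  have hcoord (x : R) : ∃ a b c d : ℤ, x = cubicCombination (u : R) a b c d :=
    exists_cubicCombination_of_mem_adjoin h4 (by rw [htop]; trivial)
  suffices key : ∀ (n : ℕ) (w : Rˣ) (a b c d : ℤ), (w : R) = cubicCombination (u : R) a b c d →
      normRat a b c d ≤ n → w ∈ Subgroup.closure {u, v} by
    obtain ⟨a, b, c, d, h⟩ := hcoord w
    exact key (normRat a b c d).toNat w a b c d h (Int.self_le_toNat _)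
  intro n
  induction n with
  | zero =>
    intro w a b c d hw hn
    obtain ⟨a', b', c', d', hw'⟩ := hcoord (w⁻¹ : Rˣ)
    have hN := hu.norm_eq_one_of_unit (hw ▸ hw' ▸ w.mul_inv)
    have := normRat_nonneg a b c d
    rw [le_antisymm (by exact_mod_cast hn) this] at hN
    nlinarith [sq_nonneg (normSqrt a b c d)]
  | succ n ih =>
    intro w a b c d hw hn
    obtain ⟨a', b', c', d', hw'⟩ := hcoord (w⁻¹ : Rˣ)
    have hN := hu.norm_eq_one_of_unit (hw ▸ hw' ▸ w.mul_inv)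
    have hP := normRat_nonneg a b c d
    push_cast at hn
    rcases lt_trichotomy (normSqrt a b c d) 0 with hQ | hQ | hQ
    · obtain ⟨e, f, g, k, hmul, hP', -⟩ := cubicCombination_mul h4 a b c d 0 0 (-1) (-1)
      refine (Subgroup.mul_mem_cancel_right _ (inv_mem hvH)).1
        (ih (w * v⁻¹) e f g k (by rw [Units.val_mul, hw, hv2, hmul]) ?_)
      rw [hP']
      have : normRat a b c d < 3 * -normSqrt a b c d := by nlinarith
      simp only [show normRat 0 0 (-1) (-1) = 2 by decide,
        show normSqrt 0 0 (-1) (-1) = 1 by decide]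
      linarith
    · obtain ⟨m, hm⟩ := exists_eq_pow_of_normRat_eq_one h4 (a := a) (b := b) (c := c) (d := d)
        (by rw [hQ] at hN; nlinarith)
      have : w = u ^ m := Units.ext (by rw [hw, hm, Units.val_pow_eq_pow_val])
      exact this ▸ pow_mem huH m
    · obtain ⟨e, f, g, k, hmul, hP', -⟩ := cubicCombination_mul h4 a b c d (-1) 1 0 0
      refine (Subgroup.mul_mem_cancel_right _ hvH).1
        (ih (w * v) e f g k (by rw [Units.val_mul, hw, hv1, hmul]) ?_)
      rw [hP']
      have : normRat a b c d < 3 * normSqrt a b c d := by nlinarith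
      simp only [show normRat (-1) 1 0 0 = 2 by decide,
        show normSqrt (-1) 1 0 0 = -1 by decide]
      linarith

theorem IsPrimitiveRoot.sub_one_pow_ne_one_of_twelve [IsDomain R] [CharZero R] {ζ : R}
    (hζ : IsPrimitiveRoot ζ 12) {n : ℕ} (hn : 0 < n) : (ζ - 1) ^ n ≠ 1 := by
  have hsub : ζ - 1 = cubicCombination ζ (-1) 1 0 0 := by simp [cubicCombination]; ring
  suffices key : ∃ a b c d : ℤ, (ζ - 1) ^ n = cubicCombination ζ a b c d ∧
      0 < normRat a b c d ∧ normSqrt a b c d < 0 by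
    obtain ⟨a, b, c, d, h, -, hQ⟩ := key
    intro h1
    exact hQ.ne (hζ.cubicCombination_eq_one (h.symm.trans h1)).2
  induction n, hn using Nat.le_induction with
  | base => exact ⟨-1, 1, 0, 0, by rw [pow_one, hsub], by decide, by decide⟩
  | succ n _ ih =>
    obtain ⟨a, b, c, d, h, hP, hQ⟩ := ih
    obtain ⟨e, f, g, k, hmul, hP', hQ'⟩ :=
      cubicCombination_mul hζ.pow_four_eq_of_twelve a b c d (-1) 1 0 0
    simp only [show normRat (-1) 1 0 0 = 2 by decide,
      show normSqrt (-1) 1 0 0 = -1 by decide] at hP' hQ'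
    exact ⟨e, f, g, k, by rw [pow_succ, h, ← hmul, ← hsub], by linarith, by linarith⟩

end IntegralRelations

/-- In the 12th cyclotomic field `E = ℚ(ζ)`, the unit group of the
ring of integers is generated by `ζ` and `ζ - 1`; moreover `ζ - 1` is a unit of
infinite order. -/
theorem units_of_twelfth_cyclotomic_field
    (ζ : 𝓞 (CyclotomicField 12 ℚ)) (hζ : IsPrimitiveRoot ζ 12) :
    ∃ u v : (𝓞 (CyclotomicField 12 ℚ))ˣ,
      (u : 𝓞 (CyclotomicField 12 ℚ)) = ζ ∧
      (v : 𝓞 (CyclotomicField 12 ℚ)) = ζ - 1 ∧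
      Subgroup.closure {u, v} = (⊤ : Subgroup (𝓞 (CyclotomicField 12 ℚ))ˣ) ∧
      ¬ IsOfFinOrder v := by
  have h4 := hζ.pow_four_eq_of_twelve
  obtain ⟨u, rfl⟩ := hζ.isUnit (by norm_num)
  have htop : Algebra.adjoin ℤ {(u : 𝓞 (CyclotomicField 12 ℚ))} = ⊤ :=
    IsCyclotomicExtension.Rat.adjoin_singleton_eq_top
      (hK := by
        convert CyclotomicField.isCyclotomicExtension 12 ℚ
        · rfl
        · exact Subsingleton.elim _ _)
      (hζ.map_of_injective RingOfIntegers.coe_injective)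
  let v : (𝓞 (CyclotomicField 12 ℚ))ˣ :=
    Units.mkOfMulEqOne ((u : 𝓞 (CyclotomicField 12 ℚ)) - 1) (-(u ^ 2 + u ^ 3))
      (by linear_combination -h4)
  refine ⟨u, v, rfl, rfl, (Subgroup.eq_top_iff' _).2
    (hζ.unit_mem_closure_of_adjoin_eq_top rfl htop), fun h => ?_⟩
  obtain ⟨n, hn, hpow⟩ := isOfFinOrder_iff_pow_eq_one.1 h
  exact hζ.sub_one_pow_ne_one_of_twelve hn (by simpa [v] using congrArg Units.val hpow)
end
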